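/- arXiv:2305.14559 — 2 statements merged into one kernel-verified Lean document; each statement's English description precedes it below -/
import Mathlib

section
/- Let 𝔣 be continuous of bounded variation with ∫_𝕋 𝔣(x) dx = 0, let 𝔭(x) = e^{𝔣(x)}/(1+e^{𝔣(x)}), and set ζ_n = ξ_{2n}. Then for every ε > 0 and every r > 0 there exists n₀ such that 1 − ε < ℙ_x(ζ_{n+j} = 0)/ℙ_x(ζ_n = 0) < 1 + ε for every n ≥ n₀, every integer j with 0 ≤ j ≤ r, and every x ∈ 𝕋. -/
open MeasureTheory Filter Finset

noncomputable section

attribute [local instance] Classical.propDecidable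

/-- The point `x + j·α` on the circle `𝕋 = ℝ/ℤ`. -/
def pt (α : ℝ) (x : UnitAddCircle) (j : ℤ) : UnitAddCircle :=
  x + (((j : ℝ) * α : ℝ) : UnitAddCircle)

/-- One-step transition probability of the random walk on `ℤ` in the quasi-periodic
environment `(𝔭, α, x)`: from `j` it jumps to `j+1` with probability `𝔭(x+jα)` and to
`j-1` with probability `𝔮(x+jα) = 1-𝔭(x+jα)`. -/
def stepProb (𝔭 : UnitAddCircle → ℝ) (α : ℝ) (x : UnitAddCircle) (j j' : ℤ) : ℝ :=
  if j' = j + 1 then 𝔭 (pt α x j) else if j' = j - 1 then 1 - 𝔭 (pt α x j) else 0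

/-- `ξ` is (a version of) the random walk on `ℤ` in the quasi-periodic environment
`(𝔭, α, x)` started at `start`, defined on the probability space `(Ω, ℙ)`; this is
expressed through its finite-dimensional distributions. -/
def IsQPWalk (𝔭 : UnitAddCircle → ℝ) (α : ℝ) (x : UnitAddCircle) (start : ℤ)
    {Ω : Type} [MeasurableSpace Ω] (ℙ : Measure Ω) (ξ : ℕ → Ω → ℤ) : Prop :=
  IsProbabilityMeasure ℙ ∧ (∀ n, Measurable (ξ n)) ∧
  ∀ (n : ℕ) (k : ℕ → ℤ),
    ℙ {ω | ∀ i ≤ n, ξ i ω = k i} =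
      ENNReal.ofReal ((if k 0 = start then (1 : ℝ) else 0) *
        ∏ i ∈ Finset.range n, stepProb 𝔭 α x (k i) (k (i + 1)))

/-- `𝔣` is continuous, of bounded variation, with `∫_𝕋 𝔣(z) dz = 0`. -/
def ZeroMeanBV (𝔣 : UnitAddCircle → ℝ) : Prop :=
  Continuous 𝔣 ∧ BoundedVariationOn (fun t : ℝ => 𝔣 (t : UnitAddCircle)) (Set.Icc 0 1) ∧
    ∫ z : UnitAddCircle, 𝔣 z = 0

/-- The function `𝔭 = e^𝔣/(1+e^𝔣)` associated to `𝔣`. -/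
def pOf (𝔣 : UnitAddCircle → ℝ) : UnitAddCircle → ℝ :=
  fun z => Real.exp (𝔣 z) / (1 + Real.exp (𝔣 z))


open Topology in
lemma weyl_monomial (α : ℝ) (hα : Irrational α) (x : UnitAddCircle) (k : ℤ) :
    Tendsto (fun n : ℕ => (∑ i ∈ range n, fourier k (x + ((((i : ℝ) * α : ℝ)) : UnitAddCircle))) / (n : ℂ)
      - ∫ z : UnitAddCircle, fourier k z) atTop (𝓝 0) := by
  rcases eq_or_ne k 0 with rfl | hk
  · have h1 : (∫ z : UnitAddCircle, (fourier 0 z : ℂ)) = 1 := by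
      simp [Measure.real, UnitAddCircle.measure_univ]
    rw [h1]
    apply Tendsto.congr' _ tendsto_const_nhds
    filter_upwards [eventually_gt_atTop 0] with n hn
    have : (n : ℂ) ≠ 0 := by exact_mod_cast hn.ne'
    simp [this]
  · have h0 : (∫ z : UnitAddCircle, (fourier k z : ℂ)) = 0 := by
      have : Fact ((0:ℝ) < 1) := ⟨one_pos⟩
      exact integral_eq_zero_of_add_right_eq_neg (fourier_add_half_inv_index hk one_pos)
    rw [h0]
    set z : ℂ := fourier k (α : UnitAddCircle) with hz
    have hz1 : z ≠ 1 := by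
      intro h
      rw [hz, fourier_coe_apply, Complex.exp_eq_one_iff] at h
      obtain ⟨m, hm⟩ := h
      have h2 : (k : ℂ) * α = m := by
        have : (2 * Real.pi * Complex.I : ℂ) ≠ 0 := Complex.two_pi_I_ne_zero
        apply mul_left_cancel₀ this
        simp at hm
        linear_combination hm
      have h3 : (k : ℝ) * α = m := by exact_mod_cast h2
      exact (hα.intCast_mul hk).ne_int m h3
    have hn1 : ‖z‖ = 1 := Circle.norm_coe _
    have hterm : ∀ i : ℕ, fourier k (x + ((((i : ℝ) * α : ℝ)) : UnitAddCircle)) = fourier k x * z ^ i := by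
      intro i
      have : ((((i : ℝ) * α : ℝ)) : UnitAddCircle) = i • (α : UnitAddCircle) := by
        rw [← nsmul_eq_mul]; rfl
      rw [this, hz]
      simp only [fourier_apply, smul_add, AddCircle.toCircle_add, Circle.coe_mul]
      rw [smul_comm, AddCircle.toCircle_nsmul]; simp
    simp only [hterm, ← mul_sum, geom_sum_eq hz1, sub_zero]
    apply squeeze_zero_norm (a := fun n : ℕ => (2 / ‖z - 1‖) * (1 / (n : ℝ)))
    · intro n
      have hx : ‖(fourier k x : ℂ)‖ = 1 := Circle.norm_coe _
      rw [norm_div, norm_mul, norm_div, hx, one_mul, div_eq_mul_one_div (a := _ / _)]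
      have : ‖z ^ n - 1‖ ≤ 2 := by
        refine (norm_sub_le _ _).trans ?_
        rw [norm_pow, hn1]; norm_num
      simp only [Complex.norm_natCast]
      gcongr
    · have := (tendsto_one_div_atTop_nhds_zero_nat (𝕜 := ℝ)).const_mul (2 / ‖z - 1‖)
      simpa using this

open Topology in
lemma weyl_cont (α : ℝ) (hα : Irrational α) (x : UnitAddCircle) (f : C(UnitAddCircle, ℂ)) :
    Tendsto (fun n : ℕ => (∑ i ∈ range n, f (x + ((((i : ℝ) * α : ℝ)) : UnitAddCircle))) / (n : ℂ)
      - ∫ z : UnitAddCircle, f z) atTop (𝓝 0) := by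
  have hint : ∀ g : C(UnitAddCircle, ℂ), Integrable (fun z => g z) (volume : Measure UnitAddCircle) := by
    intro g
    exact g.continuous.integrable_of_hasCompactSupport (HasCompactSupport.of_compactSpace _)
  have hspan : ∀ g ∈ Submodule.span ℂ (Set.range (fourier (T := 1))),
      Tendsto (fun n : ℕ => (∑ i ∈ range n, g (x + ((((i : ℝ) * α : ℝ)) : UnitAddCircle))) / (n : ℂ)
      - ∫ z : UnitAddCircle, g z) atTop (𝓝 0) := by
    intro g hg
    induction hg using Submodule.span_induction with
    | mem g hg => obtain ⟨k, rfl⟩ := hg; exact weyl_monomial α hα x k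
    | zero => simp
    | add g h _ _ ihg ihh =>
      have := ihg.add ihh
      rw [add_zero] at this
      refine this.congr fun n => ?_
      simp only [ContinuousMap.add_apply, sum_add_distrib]
      rw [integral_add (hint g) (hint h)]; ring
    | smul c g _ ih =>
      have := ih.const_mul c
      rw [mul_zero] at this
      refine this.congr fun n => ?_
      simp only [ContinuousMap.smul_apply, smul_eq_mul, ← mul_sum]
      rw [integral_const_mul]; ring
  rw [Metric.tendsto_atTop]
  intro δ hδ
  have : Fact ((0:ℝ) < 1) := ⟨one_pos⟩
  have hf : f ∈ (Submodule.span ℂ (Set.range (fourier (T := 1)))).topologicalClosure := by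
    rw [span_fourier_closure_eq_top]; trivial
  have hf' : f ∈ closure ((Submodule.span ℂ (Set.range (fourier (T := 1)))) : Set C(UnitAddCircle, ℂ)) := hf
  obtain ⟨g, hg, hfg⟩ := Metric.mem_closure_iff.1 hf' (δ / 3) (by positivity)
  obtain ⟨N, hN⟩ := Metric.tendsto_atTop.1 (hspan g hg) (δ / 3) (by positivity)
  refine ⟨N + 1, fun n hn => ?_⟩
  have h1 := hN n (by omega)
  rw [dist_zero_right] at h1 ⊢
  have hpt : ∀ z, ‖f z - g z‖ ≤ δ / 3 := by
    intro z
    rw [← dist_eq_norm]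
    exact (ContinuousMap.dist_apply_le_dist z).trans hfg.le
  have hn0 : (0:ℝ) < n := by exact_mod_cast (by omega : 0 < n)
  have e1 : ‖(∑ i ∈ range n, (f (x + ((((i : ℝ) * α : ℝ)) : UnitAddCircle)) - g (x + ((((i : ℝ) * α : ℝ)) : UnitAddCircle)))) / (n : ℂ)‖ ≤ δ / 3 := by
    rw [norm_div, Complex.norm_natCast, div_le_iff₀ hn0]
    refine (norm_sum_le_of_le _ (fun i _ => hpt _)).trans ?_
    simp [mul_comm]
  have e2 : ‖∫ z : UnitAddCircle, (f z - g z)‖ ≤ δ / 3 := by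
    refine (norm_integral_le_of_norm_le_const (C := δ / 3) (Eventually.of_forall hpt)).trans ?_
    simp [Measure.real, UnitAddCircle.measure_univ]
  rw [integral_sub (hint f) (hint g)] at e2
  rw [sum_sub_distrib, sub_div] at e1
  set A := (∑ i ∈ range n, f (x + ((((i : ℝ) * α : ℝ)) : UnitAddCircle))) / (n : ℂ)
  set B := (∑ i ∈ range n, g (x + ((((i : ℝ) * α : ℝ)) : UnitAddCircle))) / (n : ℂ)
  set I := ∫ z : UnitAddCircle, f z
  set J := ∫ z : UnitAddCircle, g z
  have : A - I = (A - B) + (B - J) - (I - J) := by ring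
  rw [this]
  have t1 := norm_sub_le ((A - B) + (B - J)) (I - J)
  have t2 := norm_add_le (A - B) (B - J)
  linarith

open Topology in
lemma weyl_real (α : ℝ) (hα : Irrational α) (x : UnitAddCircle) (f : UnitAddCircle → ℝ) (hf : Continuous f)
    (h0 : ∫ z : UnitAddCircle, f z = 0) :
    Tendsto (fun n : ℕ => (∑ i ∈ range n, f (x + ((((i : ℝ) * α : ℝ)) : UnitAddCircle))) / (n : ℝ)) atTop (𝓝 0) := by
  have h := weyl_cont α hα x ⟨fun z => (f z : ℂ), by fun_prop⟩
  simp only [ContinuousMap.coe_mk] at h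
  have hI : (∫ z : UnitAddCircle, (f z : ℂ)) = 0 := by
    have := integral_ofReal (𝕜 := ℂ) (μ := (volume : Measure UnitAddCircle)) (f := f)
    rw [h0] at this
    simpa using this
  rw [hI] at h
  have h2 := (Complex.continuous_re.tendsto 0).comp h
  refine (h2.congr fun n => ?_)
  simp only [Function.comp]
  rw [← Complex.ofReal_sum]
  norm_cast
  simp

def bk (p : ℤ → ℝ) : ℕ → ℤ → ℝ
  | 0 => fun k => if k = 0 then 1 else 0
  | n + 1 => fun k => p k * bk p n (k + 1) + (1 - p k) * bk p n (k - 1)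

lemma bk_succ (p : ℤ → ℝ) (n : ℕ) (k : ℤ) :
    bk p (n + 1) k = p k * bk p n (k + 1) + (1 - p k) * bk p n (k - 1) := rfl

lemma bk_nonneg (p : ℤ → ℝ) (h0 : ∀ k, 0 < p k) (h1 : ∀ k, p k < 1) (n : ℕ) (k : ℤ) : 0 ≤ bk p n k := by
  induction n generalizing k with
  | zero => simp only [bk]; split_ifs <;> norm_num
  | succ n ih =>
    rw [bk_succ]
    have := h0 k; have := h1 k
    exact add_nonneg (mul_nonneg (h0 k).le (ih _)) (mul_nonneg (by linarith) (ih _))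

lemma bk_le_one (p : ℤ → ℝ) (h0 : ∀ k, 0 < p k) (h1 : ∀ k, p k < 1) (n : ℕ) (k : ℤ) : bk p n k ≤ 1 := by
  induction n generalizing k with
  | zero => simp only [bk]; split_ifs <;> norm_num
  | succ n ih =>
    rw [bk_succ]
    have := h0 k; have := h1 k; have := ih (k+1); have := ih (k-1)
    nlinarith

lemma bk_pos (p : ℤ → ℝ) (h0 : ∀ k, 0 < p k) (h1 : ∀ k, p k < 1) (n : ℕ) : 0 < bk p (2 * n) 0 := by
  induction n with
  | zero => simp [bk]
  | succ n ih =>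
    have e : 2 * (n + 1) = (2 * n + 1) + 1 := by ring
    rw [e, bk_succ]
    have h2 : 0 < bk p (2 * n + 1) (0 + 1) := by
      rw [bk_succ]
      have := h1 1
      have a1 := bk_nonneg p h0 h1 (2 * n) (0 + 1 + 1)
      have a2 := h0 (0 + 1)
      have a3 : 0 < 1 - p (0 + 1) := sub_pos.2 (h1 _)
      have : (0 : ℤ) + 1 - 1 = 0 := by norm_num
      rw [this]
      positivity
    have a1 := bk_nonneg p h0 h1 (2 * n + 1) (0 - 1)
    have a2 := h0 0
    have a3 : 0 < 1 - p 0 := sub_pos.2 (h1 _)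
    positivity

lemma bk_supp (p : ℤ → ℝ) (n : ℕ) : (Function.support (bk p n)).Finite := by
  have : ∀ k : ℤ, (n : ℤ) < |k| → bk p n k = 0 := by
    induction n with
    | zero => intro k hk; simp only [bk]; rw [if_neg]; rintro rfl; simp at hk
    | succ n ih =>
      intro k hk
      push_cast at hk
      rw [bk_succ, ih, ih]
      · simp
      · rcases abs_cases k with h | h <;> rcases abs_cases (k - 1) with h' | h' <;> omega
      · rcases abs_cases k with h | h <;> rcases abs_cases (k + 1) with h' | h' <;> omega
  refine (Set.finite_Icc (-(n : ℤ)) n).subset ?_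
  intro k hk
  by_contra hc
  apply hk
  apply this
  by_contra h
  exact hc (abs_le.1 (not_lt.1 h))

lemma summ_bk (p : ℤ → ℝ) (n : ℕ) (e : ℤ → ℤ) (he : Function.Injective e) (F : ℤ → ℝ → ℝ) (hF : ∀ k, F k 0 = 0) :
    Summable (fun k => F k (bk p n (e k))) := by
  apply summable_of_hasFiniteSupport
  refine ((bk_supp p n).preimage (he.injOn)).subset ?_
  intro k hk
  simp only [Set.mem_preimage, Function.mem_support] at hk ⊢
  intro h
  apply hk
  rw [h, hF]

section env
variable (C : ℤ → ℝ) (p : ℤ → ℝ)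

def IPb (C p : ℤ → ℝ) (m n : ℕ) : ℝ := ∑' k : ℤ, (C k + C (k - 1)) * bk p m k * bk p n k

lemma w_bk (hC : ∀ k, 0 < C k) (hp : ∀ k, p k = C k / (C k + C (k - 1))) (n : ℕ) (k : ℤ) :
    (C k + C (k - 1)) * bk p (n + 1) k = C k * bk p n (k + 1) + C (k - 1) * bk p n (k - 1) := by
  have h1 := hC k
  have h2 := hC (k - 1)
  rw [bk_succ, hp]
  field_simp
  ring

lemma IPb_expand (hC : ∀ k, 0 < C k) (hp : ∀ k, p k = C k / (C k + C (k - 1))) (m n : ℕ) :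
    IPb C p (m + 1) n = (∑' k : ℤ, C k * bk p m (k + 1) * bk p n k) + ∑' k : ℤ, C k * bk p m k * bk p n (k + 1) := by
  have e : ∀ k : ℤ, (C k + C (k - 1)) * bk p (m + 1) k * bk p n k =
      C k * bk p m (k + 1) * bk p n k + C (k - 1) * bk p m (k - 1) * bk p n k := by
    intro k; rw [w_bk C p hC hp]; ring
  unfold IPb
  rw [tsum_congr e, Summable.tsum_add]
  · congr 1
    rw [← (Equiv.addRight (1 : ℤ)).tsum_eq (fun k => C (k - 1) * bk p m (k - 1) * bk p n k)]
    simp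
  · exact summ_bk p n id Function.injective_id (fun k y => C k * bk p m (k + 1) * y) (by simp)
  · exact summ_bk p n id Function.injective_id (fun k y => C (k - 1) * bk p m (k - 1) * y) (by simp)

lemma IPb_symm (m n : ℕ) : IPb C p m n = IPb C p n m := by
  unfold IPb; exact tsum_congr fun k => by ring

lemma IPb_shift (hC : ∀ k, 0 < C k) (hp : ∀ k, p k = C k / (C k + C (k - 1))) (m n : ℕ) :
    IPb C p (m + 1) n = IPb C p m (n + 1) := by
  rw [IPb_symm C p m, IPb_expand C p hC hp, IPb_expand C p hC hp, add_comm]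
  congr 1 <;> exact tsum_congr fun k => by ring

lemma IPb_eq (hC : ∀ k, 0 < C k) (hp : ∀ k, p k = C k / (C k + C (k - 1))) (m n : ℕ) :
    IPb C p m n = (C 0 + C (0 - 1)) * bk p (m + n) 0 := by
  induction m generalizing n with
  | zero =>
    unfold IPb
    rw [tsum_eq_single 0]
    · simp [bk]
    · intro k hk; simp [bk, hk]
  | succ m ih => rw [IPb_shift C p hC hp, ih]; congr 2; ring

lemma bk_sq_le (hC : ∀ k, 0 < C k) (hp : ∀ k, p k = C k / (C k + C (k - 1))) (n : ℕ) (k : ℤ) :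
    (C k + C (k - 1)) * (bk p n k) ^ 2 ≤ (C 0 + C (0 - 1)) * bk p (2 * n) 0 := by
  rw [two_mul, ← IPb_eq C p hC hp]
  unfold IPb
  have := Summable.le_tsum (f := fun k : ℤ => (C k + C (k - 1)) * bk p n k * bk p n k)
    (summ_bk p n id Function.injective_id (fun k y => (C k + C (k - 1)) * bk p n k * y) (by simp)) k
    (fun j _ => by
      have := hC j; have := hC (j - 1)
      rw [mul_assoc]
      exact mul_nonneg (by linarith) (mul_self_nonneg _))
  refine le_trans (le_of_eq ?_) this
  ring

lemma p_bds (hC : ∀ k, 0 < C k) (hp : ∀ k, p k = C k / (C k + C (k - 1))) : (∀ k, 0 < p k) ∧ ∀ k, p k < 1 := by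
  refine ⟨fun k => ?_, fun k => ?_⟩
  · have := hC k; have := hC (k - 1); rw [hp]; positivity
  · have := hC k; have := hC (k - 1); rw [hp, div_lt_one (by positivity)]; linarith

lemma logconv (hC : ∀ k, 0 < C k) (hp : ∀ k, p k = C k / (C k + C (k - 1))) (n : ℕ) :
    bk p (2 * (n + 1)) 0 ^ 2 ≤ bk p (2 * n) 0 * bk p (2 * (n + 2)) 0 := by
  obtain ⟨h0, h1⟩ := p_bds C p hC hp
  have hw : 0 < C 0 + C (0 - 1) := add_pos (hC _) (hC _)
  have hun := bk_pos p h0 h1 n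
  set a := bk p (2 * n) 0 with ha
  set b := bk p (2 * (n + 1)) 0 with hb
  set c := bk p (2 * (n + 2)) 0 with hc
  have s : ∀ i j, Summable fun k : ℤ => (C k + C (k - 1)) * bk p i k * bk p j k := fun i j =>
    summ_bk p j id Function.injective_id (fun k y => (C k + C (k - 1)) * bk p i k * y) (by simp)
  have key : 0 ≤ ∑' k : ℤ, (C k + C (k - 1)) * (b * bk p n k - a * bk p (n + 2) k) ^ 2 := by
    apply tsum_nonneg
    intro k
    have := hC k; have := hC (k - 1)
    positivity
  have e : ∀ k : ℤ, (C k + C (k - 1)) * (b * bk p n k - a * bk p (n + 2) k) ^ 2 =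
      b ^ 2 * ((C k + C (k - 1)) * bk p n k * bk p n k) + (-(2 * a * b)) * ((C k + C (k - 1)) * bk p n k * bk p (n + 2) k)
       + a ^ 2 * ((C k + C (k - 1)) * bk p (n + 2) k * bk p (n + 2) k) := by intro k; ring
  rw [tsum_congr e, Summable.tsum_add (((s n n).mul_left _).add ((s n (n+2)).mul_left _)) ((s (n+2) (n+2)).mul_left _),
    Summable.tsum_add ((s n n).mul_left _) ((s n (n+2)).mul_left _), tsum_mul_left, tsum_mul_left, tsum_mul_left] at key
  have i1 := IPb_eq C p hC hp n n
  have i2 := IPb_eq C p hC hp n (n + 2)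
  have i3 := IPb_eq C p hC hp (n + 2) (n + 2)
  rw [show n + n = 2 * n by ring, ← ha] at i1
  rw [show n + (n + 2) = 2 * (n + 1) by ring, ← hb] at i2
  rw [show n + 2 + (n + 2) = 2 * (n + 2) by ring, ← hc] at i3
  unfold IPb at i1 i2 i3
  rw [i1, i2, i3] at key
  have : 0 ≤ ((C 0 + C (0 - 1)) * a) * (a * c - b ^ 2) := by linarith
  have := nonneg_of_mul_nonneg_right this (by positivity)
  linarith

lemma barta (hC : ∀ k, 0 < C k) (hp : ∀ k, p k = C k / (C k + C (k - 1))) (g : ℤ → ℝ) (hg : ∀ k, 0 < g k)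
    (μ : ℝ) (h : ∀ k, p k * g (k + 1) + (1 - p k) * g (k - 1) ≤ μ * g k) (A : ℤ) (n : ℕ) :
    (1 - μ) * ∑ i ∈ range (n + 1), (C (A + i) + C (A + i - 1)) ≤
      C (A - 1) + C (A + n) - C (A + n) * (g (A + n + 1) / g (A + n)) := by
  have hk : ∀ k, (1 - μ) * (C k + C (k - 1)) ≤ C k + C (k - 1) - C k * (g (k + 1) / g k) - C (k - 1) * (g (k - 1) / g k) := by
    intro k
    have h1 := hC k
    have h2 := hC (k - 1)
    have h3 := h k
    have h4 := hg k
    have h5 : C k * g (k + 1) + C (k - 1) * g (k - 1) ≤ μ * (C k + C (k - 1)) * g k := by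
      have : (C k + C (k - 1)) * (p k * g (k + 1) + (1 - p k) * g (k - 1)) = C k * g (k + 1) + C (k - 1) * g (k - 1) := by
        rw [hp]; field_simp; ring
      rw [← this]
      have := mul_le_mul_of_nonneg_left h3 (by positivity : 0 ≤ C k + C (k - 1))
      linarith
    have h6 : C k * (g (k + 1) / g k) + C (k - 1) * (g (k - 1) / g k) ≤ μ * (C k + C (k - 1)) := by
      rw [← mul_div_assoc, ← mul_div_assoc, ← add_div, div_le_iff₀ h4]; exact h5
    linarith
  induction n with
  | zero =>
    have := hk A
    have h1 : 0 ≤ C (A - 1) * (g (A - 1) / g A) := (mul_pos (hC _) (div_pos (hg _) (hg _))).le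
    simp
    linarith
  | succ n ih =>
    rw [sum_range_succ, mul_add]
    have h1 := hk (A + ((n + 1 : ℕ) : ℤ))
    have e1 : A + ((n + 1 : ℕ) : ℤ) - 1 = A + n := by push_cast; ring
    have e2 : A + (n : ℤ) + 1 = A + ((n + 1 : ℕ) : ℤ) := by push_cast; ring
    rw [e2] at ih
    rw [e1] at h1 ⊢
    set x := g (A + n) with hx
    set y := g (A + ((n + 1 : ℕ) : ℤ)) with hy
    have hx0 : 0 < x := hg _
    have hy0 : 0 < y := hg _
    have h2 : 2 ≤ y / x + x / y := by
      rw [div_add_div _ _ hx0.ne' hy0.ne', le_div_iff₀ (by positivity)]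
      nlinarith [sq_nonneg (x - y)]
    have h3 := mul_le_mul_of_nonneg_left h2 (hC (A + n)).le
    linarith

lemma no_decay (hC : ∀ k, 0 < C k) (hp : ∀ k, p k = C k / (C k + C (k - 1)))
    (hright : ∀ ε > 0, ∃ N : ℕ, C N ≤ ε * ∑ i ∈ range (N + 1), C i)
    (hleft : ∀ ε > 0, ∃ N : ℕ, C (-1 - N) ≤ ε * ∑ i ∈ range (N + 1), C (-1 - i))
    (μ : ℝ) (hμ0 : 0 < μ) (hμ1 : μ < 1) (h : ∀ n, bk p (2 * n) 0 ≤ (μ ^ 4) ^ n) : False := by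
  obtain ⟨h0, h1⟩ := p_bds C p hC hp
  have hw : ∀ k, 0 < C k + C (k - 1) := fun k => add_pos (hC _) (hC _)
  have hb : ∀ n k, bk p n k ≤ Real.sqrt ((C 0 + C (0 - 1)) / (C k + C (k - 1))) * μ ^ (2 * n) := by
    intro n k
    have e1 := bk_sq_le C p hC hp n k
    have e2 := h n
    have e3 : bk p n k ^ 2 ≤ (C 0 + C (0 - 1)) / (C k + C (k - 1)) * (μ ^ (2 * n)) ^ 2 := by
      rw [div_mul_eq_mul_div, le_div_iff₀ (hw k)]
      calc _ = (C k + C (k - 1)) * (bk p n k) ^ 2 := by ring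
        _ ≤ _ := e1
        _ ≤ (C 0 + C (0 - 1)) * (μ ^ 4) ^ n := by
          have := hw 0
          gcongr
        _ = _ := by rw [← pow_mul, ← pow_mul]; ring_nf
    have e4 := Real.le_sqrt_of_sq_le e3
    rwa [Real.sqrt_mul (div_pos (hw _) (hw _)).le, Real.sqrt_sq (by positivity)] at e4
  have hs : ∀ k, Summable fun n : ℕ => bk p n k * (1 / μ) ^ n := by
    intro k
    refine Summable.of_nonneg_of_le (f := fun n => Real.sqrt ((C 0 + C (0 - 1)) / (C k + C (k - 1))) * μ ^ n) ?_ ?_ ?_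
    · intro n; have := bk_nonneg p h0 h1 n k; positivity
    · intro n
      have := mul_le_mul_of_nonneg_right (hb n k) (by positivity : 0 ≤ (1 / μ) ^ n)
      refine this.trans (le_of_eq ?_)
      rw [mul_assoc]; congr 1
      rw [two_mul, pow_add, mul_assoc, ← mul_pow, mul_one_div_cancel hμ0.ne', one_pow, mul_one]
    · exact (summable_geometric_of_lt_one hμ0.le hμ1).mul_left _
  set g : ℤ → ℝ := fun k => ∑' n : ℕ, bk p n k * (1 / μ) ^ n with hgdef
  have hgnn : ∀ k, 0 ≤ g k := fun k => tsum_nonneg fun n => by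
    have := bk_nonneg p h0 h1 n k; positivity
  have hgeq : ∀ k, g k = bk p 0 k + (1 / μ) * (p k * g (k + 1) + (1 - p k) * g (k - 1)) := by
    intro k
    simp only [hgdef]
    rw [(hs k).tsum_eq_zero_add]
    congr 1
    · simp
    rw [← tsum_mul_left, ← tsum_mul_left, ← Summable.tsum_add, ← tsum_mul_left]
    · apply tsum_congr; intro n; rw [bk_succ]; ring
    · exact (hs _).mul_left _
    · exact (hs _).mul_left _
  have hsup : ∀ k, p k * g (k + 1) + (1 - p k) * g (k - 1) ≤ μ * g k := by
    intro k
    have e := hgeq k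
    have e2 := bk_nonneg p h0 h1 0 k
    rw [e, mul_add, ← mul_assoc, mul_one_div_cancel hμ0.ne', one_mul]
    have : 0 ≤ μ * bk p 0 k := by positivity
    linarith
  have hg0 : 0 < g 0 := by
    rw [hgeq 0]
    have a1 := hgnn (0 + 1); have a2 := hgnn (0 - 1); have a3 := h0 0
    have a4 := sub_pos.2 (h1 0)
    have : bk p 0 0 = 1 := by simp [bk]
    rw [this]; positivity
  have hg : ∀ k, 0 < g k := by
    intro k
    induction k using Int.induction_on with
    | zero => exact hg0
    | succ i ih =>
      have e := hsup (i + 1)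
      have : (i : ℤ) + 1 - 1 = i := by ring
      rw [this] at e
      have a1 := mul_nonneg (h0 (i + 1)).le (hgnn (i + 1 + 1))
      have a2 := mul_pos (sub_pos.2 (h1 (i + 1))) ih
      exact pos_of_mul_pos_right (by linarith : 0 < μ * g (i + 1)) hμ0.le
    | pred i ih =>
      have e := hsup (-i - 1)
      have : -(i : ℤ) - 1 + 1 = -i := by ring
      rw [this] at e
      have a1 := mul_nonneg (sub_pos.2 (h1 (-i - 1))).le (hgnn (-i - 1 - 1))
      have a2 := mul_pos (h0 (-i - 1)) ih
      exact pos_of_mul_pos_right (by linarith : 0 < μ * g (-i - 1)) hμ0.le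
  obtain ⟨N, hN⟩ := hright ((1 - μ) / 3) (by linarith)
  obtain ⟨M, hM⟩ := hleft ((1 - μ) / 3) (by linarith)
  have hB := barta C p hC hp g hg μ hsup (-M) (M + N)
  set W := ∑ i ∈ range (M + N + 1), (C (-M + i) + C (-M + i - 1)) with hW
  have e1 : -(M : ℤ) + ((M + N : ℕ) : ℤ) = N := by push_cast; ring
  have e2 : -(M : ℤ) - 1 = -1 - M := by ring
  rw [e1, e2] at hB
  have hpos : 0 < C N * (g (N + 1) / g N) := mul_pos (hC _) (div_pos (hg _) (hg _))
  have hWN : ∑ i ∈ range (N + 1), C i ≤ W := by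
    rw [hW, add_assoc, sum_range_add (fun i : ℕ => (C (-M + i) + C (-M + i - 1))) M (N + 1)]
    have t1 : 0 ≤ ∑ i ∈ range M, (C (-M + i) + C (-M + i - 1)) := sum_nonneg fun i _ => (hw _).le
    have t2 : ∑ i ∈ range (N + 1), C i ≤ ∑ i ∈ range (N + 1), (C (-M + ((M + i : ℕ) : ℤ)) + C (-M + ((M + i : ℕ) : ℤ) - 1)) := by
      apply sum_le_sum
      intro i _
      have : -(M : ℤ) + ((M + i : ℕ) : ℤ) = i := by push_cast; ring
      rw [this]
      have := hC (i - 1)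
      linarith
    linarith
  have hWM : ∑ i ∈ range (M + 1), C (-1 - i) ≤ W := by
    rw [hW, show M + N + 1 = (M + 1) + N by ring, sum_range_add (fun i : ℕ => (C (-M + i) + C (-M + i - 1))) (M + 1) N]
    have t1 : 0 ≤ ∑ i ∈ range N, (C (-M + ((M + 1 + i : ℕ) : ℤ)) + C (-M + ((M + 1 + i : ℕ) : ℤ) - 1)) := sum_nonneg fun i _ => (hw _).le
    have t2 : ∑ i ∈ range (M + 1), C (-1 - i) ≤ ∑ i ∈ range (M + 1), (C (-M + i) + C (-M + i - 1)) := by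
      rw [← sum_range_reflect]
      apply sum_le_sum
      intro i hi
      rw [Finset.mem_range] at hi
      have : (-1 : ℤ) - ((M + 1 - 1 - i : ℕ) : ℤ) = -M + i - 1 := by omega
      rw [this]
      have := hC (-M + i)
      linarith
    linarith
  have hWpos : 0 < W := sum_pos (fun i _ => hw _) (by simp)
  have : 0 < (1 - μ) / 3 := by linarith
  nlinarith

end env

open Topology in
lemma bdry (c : ℕ → ℝ) (V : ℕ → ℝ) (hc : ∀ n, c n = Real.exp (V n))
    (hV : Tendsto (fun n : ℕ => V n / (n : ℝ)) atTop (𝓝 0)) (ε : ℝ) (hε : 0 < ε) :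
    ∃ N : ℕ, c N ≤ ε * ∑ i ∈ range (N + 1), c i := by
  by_contra! hcon
  have hpos : ∀ n, 0 < c n := fun n => by rw [hc]; exact Real.exp_pos _
  have hT : ∀ N : ℕ, (1 + ε) ^ N * c 0 ≤ ∑ i ∈ range (N + 1), c i := by
    intro N
    induction N with
    | zero => simp
    | succ N ih =>
      have h1 := hcon (N + 1)
      rw [sum_range_succ] at h1 ⊢
      have := hpos (N + 1)
      rw [pow_succ]
      nlinarith
  have hV2 : ∀ N : ℕ, Real.log (ε * c 0) + N * Real.log (1 + ε) ≤ V N := by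
    intro N
    have h0 := hpos 0
    have h1 : (ε * c 0) * (1 + ε) ^ N ≤ Real.exp (V N) := by
      rw [← hc]
      have := mul_le_mul_of_nonneg_left (hT N) hε.le
      have := hcon N
      linarith
    have := Real.log_le_log (by positivity) h1
    rwa [Real.log_exp, Real.log_mul (by positivity) (by positivity), Real.log_pow] at this
  have hl : 0 < Real.log (1 + ε) := Real.log_pos (by linarith)
  have ht : Tendsto (fun N : ℕ => Real.log (ε * c 0) * (1 / (N : ℝ)) + Real.log (1 + ε)) atTop (𝓝 (Real.log (ε * c 0) * 0 + Real.log (1 + ε))) :=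
    ((tendsto_one_div_atTop_nhds_zero_nat (𝕜 := ℝ)).const_mul _).add_const _
  rw [mul_zero, zero_add] at ht
  have := le_of_tendsto_of_tendsto ht hV (by
    filter_upwards [eventually_gt_atTop 0] with N hN
    have hN' : (0 : ℝ) < N := by exact_mod_cast hN
    rw [le_div_iff₀ hN']
    have := hV2 N
    field_simp
    linarith)
  linarith

lemma walk_joint {𝔭 : UnitAddCircle → ℝ} {α : ℝ} {x : UnitAddCircle}
    {Ω : Type} [MeasurableSpace Ω] {ℙ : Measure Ω} {ξ : ℕ → Ω → ℤ}
    (hp0 : ∀ z, 0 ≤ 𝔭 z) (hp1 : ∀ z, 𝔭 z ≤ 1)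
    (h : IsQPWalk 𝔭 α x 0 ℙ ξ) (n : ℕ) (j k : ℤ) :
    ℙ {ω | ξ n ω = j ∧ ξ (n + 1) ω = k} = ℙ {ω | ξ n ω = j} * ENNReal.ofReal (stepProb 𝔭 α x j k) := by
  obtain ⟨_, hm, hfd⟩ := h
  have hstep : ∀ a b, 0 ≤ stepProb 𝔭 α x a b := by
    intro a b; unfold stepProb
    split_ifs
    · exact hp0 _
    · exact sub_nonneg.2 (hp1 _)
    · exact le_rfl
  let S : (Fin (n + 1) → ℤ) → Set Ω := fun g => {ω | ∀ i : Fin (n + 1), ξ i ω = g i}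
  have hSm : ∀ g, MeasurableSet (S g) := by
    intro g
    have : S g = ⋂ i : Fin (n + 1), (ξ i) ⁻¹' {g i} := by ext ω; simp [S]
    rw [this]
    exact MeasurableSet.iInter fun i => (hm _) (measurableSet_singleton _)
  have hdisj : Pairwise (Function.onFun Disjoint S) := by
    intro g g' hne
    rw [Function.onFun, Set.disjoint_left]
    intro ω h1 h2
    apply hne
    funext i
    rw [← h1 i, ← h2 i]
  have hdec : ∀ A : Set Ω, MeasurableSet A → ℙ A = ∑' g, ℙ (A ∩ S g) := by
    intro A hA
    rw [← measure_iUnion]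
    · congr 1
      ext ω
      simp only [Set.mem_iUnion, Set.mem_inter_iff]
      constructor
      · intro hω; exact ⟨fun i => ξ i ω, hω, fun i => rfl⟩
      · rintro ⟨_, h, _⟩; exact h
    · intro g g' hne
      exact (hdisj hne).mono Set.inter_subset_right Set.inter_subset_right
    · intro g; exact hA.inter (hSm g)
  have hA : MeasurableSet {ω | ξ n ω = j} := (hm n) (measurableSet_singleton j)
  have hB : MeasurableSet {ω | ξ (n + 1) ω = k} := (hm (n + 1)) (measurableSet_singleton k)
  rw [hdec {ω | ξ n ω = j} hA, hdec {ω | ξ n ω = j ∧ ξ (n + 1) ω = k} (hA.inter hB), ← ENNReal.tsum_mul_right]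
  apply tsum_congr
  intro g
  by_cases hg : g (Fin.last n) = j
  · let K : ℕ → ℤ := fun i => if hi : i < n + 1 then g ⟨i, hi⟩ else k
    have hKn : K n = j := by simp only [K]; rw [dif_pos (Nat.lt_succ_self n)]; exact hg
    have hKn1 : K (n + 1) = k := by simp [K]
    have e1 : {ω | ξ n ω = j} ∩ S g = {ω | ∀ i ≤ n, ξ i ω = K i} := by
      ext ω
      simp only [Set.mem_inter_iff, Set.mem_setOf_eq, S, K]
      constructor
      · rintro ⟨_, h⟩ i hi
        rw [dif_pos (Nat.lt_succ_of_le hi)]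
        exact h ⟨i, Nat.lt_succ_of_le hi⟩
      · intro h
        refine ⟨?_, fun i => ?_⟩
        · rw [h n le_rfl]; exact hKn
        · have := h i (Nat.le_of_lt_succ i.2)
          rw [dif_pos i.2] at this
          exact this
    have e2 : {ω | ξ n ω = j ∧ ξ (n + 1) ω = k} ∩ S g = {ω | ∀ i ≤ n + 1, ξ i ω = K i} := by
      have : {ω | ξ n ω = j ∧ ξ (n + 1) ω = k} ∩ S g = ({ω | ξ n ω = j} ∩ S g) ∩ {ω | ξ (n + 1) ω = k} := by
        ext ω; simp only [Set.mem_inter_iff, Set.mem_setOf_eq]; tauto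
      rw [this, e1]
      ext ω
      simp only [Set.mem_inter_iff, Set.mem_setOf_eq]
      constructor
      · rintro ⟨h1, h2⟩ i hi
        rcases Nat.lt_or_ge i (n + 1) with h | h
        · exact h1 i (by omega)
        · have : i = n + 1 := by omega
          rw [this, hKn1, h2]
      · intro h
        exact ⟨fun i hi => h i (by omega), by rw [h (n + 1) le_rfl, hKn1]⟩
    rw [e1, e2, hfd, hfd, prod_range_succ, ← mul_assoc, ENNReal.ofReal_mul, hKn, hKn1]
    apply mul_nonneg
    · split_ifs <;> norm_num
    · exact prod_nonneg fun i _ => hstep _ _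
  · have e1 : {ω | ξ n ω = j} ∩ S g = ∅ := by
      ext ω
      simp only [Set.mem_inter_iff, Set.mem_setOf_eq, S, Set.mem_empty_iff_false, iff_false]
      rintro ⟨h1, h2⟩
      apply hg
      rw [← h2 (Fin.last n)]; exact h1
    have e2 : {ω | ξ n ω = j ∧ ξ (n + 1) ω = k} ∩ S g = ∅ := by
      rw [← Set.subset_empty_iff, ← e1]
      rintro ω ⟨⟨h1, _⟩, h2⟩
      exact ⟨h1, h2⟩
    rw [e1, e2]; simp

lemma walk_rec {𝔭 : UnitAddCircle → ℝ} {α : ℝ} {x : UnitAddCircle}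
    {Ω : Type} [MeasurableSpace Ω] {ℙ : Measure Ω} {ξ : ℕ → Ω → ℤ}
    (hp0 : ∀ z, 0 ≤ 𝔭 z) (hp1 : ∀ z, 𝔭 z ≤ 1)
    (h : IsQPWalk 𝔭 α x 0 ℙ ξ) (n : ℕ) (k : ℤ) :
    ℙ {ω | ξ (n + 1) ω = k} = ℙ {ω | ξ n ω = k - 1} * ENNReal.ofReal (𝔭 (pt α x (k - 1))) +
      ℙ {ω | ξ n ω = k + 1} * ENNReal.ofReal (1 - 𝔭 (pt α x (k + 1))) := by
  have hj := walk_joint hp0 hp1 h n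
  obtain ⟨_, hm, _⟩ := h
  have hB : MeasurableSet {ω | ξ (n + 1) ω = k} := (hm (n + 1)) (measurableSet_singleton k)
  have hdec : ℙ {ω | ξ (n + 1) ω = k} = ∑' j : ℤ, ℙ {ω | ξ n ω = j ∧ ξ (n + 1) ω = k} := by
    rw [← measure_iUnion]
    · congr 1; ext ω; simp
    · intro g g' hne
      rw [Function.onFun, Set.disjoint_left]
      rintro ω ⟨h1, _⟩ ⟨h2, _⟩
      exact hne (h1.symm.trans h2)
    · intro j
      exact ((hm n) (measurableSet_singleton j)).inter hB
  rw [hdec, tsum_eq_sum (s := {k - 1, k + 1}), sum_pair (by omega), hj, hj]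
  · congr 3
    · unfold stepProb; rw [if_pos (by ring)]
    · unfold stepProb; rw [if_neg (by omega), if_pos (by ring)]
  · intro j hjn
    simp only [Finset.mem_insert, Finset.mem_singleton, not_or] at hjn
    rw [hj]; unfold stepProb
    rw [if_neg (by omega), if_neg (by omega)]; simp

lemma walk_prob {𝔭 : UnitAddCircle → ℝ} {α : ℝ} {x : UnitAddCircle}
    {Ω : Type} [MeasurableSpace Ω] {ℙ : Measure Ω} {ξ : ℕ → Ω → ℤ}
    (h : IsQPWalk 𝔭 α x 0 ℙ ξ) (hp0 : ∀ z, 0 ≤ 𝔭 z) (hp1 : ∀ z, 𝔭 z ≤ 1)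
    (C : ℤ → ℝ) (hC : ∀ k, 0 < C k) (hp : ∀ k, 𝔭 (pt α x k) = C k / (C k + C (k - 1))) (n : ℕ) (k : ℤ) :
    (ℙ {ω | ξ n ω = k}).toReal = (C k + C (k - 1)) / (C 0 + C (0 - 1)) * bk (fun k => 𝔭 (pt α x k)) n k := by
  have hw : ∀ k, 0 < C k + C (k - 1) := fun k => add_pos (hC _) (hC _)
  have hr := walk_rec hp0 hp1 h
  obtain ⟨_, hm, hfd⟩ := h
  induction n generalizing k with
  | zero =>
    have := hfd 0 (fun _ => k)
    simp only [Nat.le_zero, forall_eq, range_zero, prod_empty, mul_one] at this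
    rw [this]
    simp only [bk]
    split_ifs with hk
    · subst hk
      have := (hw 0).ne'
      simp only [ENNReal.ofReal_one, ENNReal.toReal_one]
      field_simp
    · simp
  | succ n ih =>
    rw [hr, ENNReal.toReal_add (by finiteness) (by finiteness), ENNReal.toReal_mul, ENNReal.toReal_mul, ih, ih,
      ENNReal.toReal_ofReal (hp0 _), ENNReal.toReal_ofReal (sub_nonneg.2 (hp1 _)), div_mul_eq_mul_div (C k + _),
      w_bk C (fun k => 𝔭 (pt α x k)) hC hp, hp, hp]
    have e1 : k + 1 - 1 = k := by ring
    rw [e1]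
    have := hw 0
    have h1 := (hw (k - 1))
    have h2 := (hw (k + 1))
    rw [e1] at h2
    field_simp
    ring

def Vd (f : ℤ → ℝ) : ℤ → ℝ
  | Int.ofNat n => ∑ i ∈ range n, f (i + 1)
  | Int.negSucc n => - ∑ i ∈ range (n + 1), f (-i)

lemma Vd_nat (f : ℤ → ℝ) (n : ℕ) : Vd f n = ∑ i ∈ range n, f (i + 1) := rfl

lemma Vd_neg (f : ℤ → ℝ) (n : ℕ) : Vd f (-1 - n) = - ∑ i ∈ range (n + 1), f (-i) := by
  have : (-1 - n : ℤ) = Int.negSucc n := by omega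
  rw [this]; rfl

lemma Vd_step (f : ℤ → ℝ) (k : ℤ) : Vd f k = Vd f (k - 1) + f k := by
  rcases lt_trichotomy k 0 with h | h | h
  · obtain ⟨n, rfl⟩ : ∃ n : ℕ, k = -1 - n := ⟨(-1 - k).toNat, by omega⟩
    have : (-1 - n - 1 : ℤ) = -1 - (n + 1 : ℕ) := by push_cast; ring
    rw [this, Vd_neg, Vd_neg, sum_range_succ _ (n + 1)]
    have : (-((n + 1 : ℕ) : ℤ)) = -1 - n := by push_cast; ring
    rw [this]; ring
  · subst h
    have h1 := Vd_nat f 0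
    have h2 := Vd_neg f 0
    simp at h1 h2 ⊢
    rw [h1, h2]; ring
  · obtain ⟨n, rfl⟩ : ∃ n : ℕ, k = (n + 1 : ℕ) := ⟨(k - 1).toNat, by omega⟩
    have : ((n + 1 : ℕ) : ℤ) - 1 = n := by push_cast; ring
    rw [this, Vd_nat, Vd_nat, sum_range_succ]; push_cast; rfl

def Cd (α : ℝ) (𝔣 : UnitAddCircle → ℝ) (x : UnitAddCircle) (k : ℤ) : ℝ := Real.exp (Vd (fun k => 𝔣 (pt α x k)) k)

lemma Cd_pos (α : ℝ) (𝔣 : UnitAddCircle → ℝ) (x : UnitAddCircle) (k : ℤ) : 0 < Cd α 𝔣 x k := Real.exp_pos _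

lemma Cd_p (α : ℝ) (𝔣 : UnitAddCircle → ℝ) (x : UnitAddCircle) (k : ℤ) :
    pOf 𝔣 (pt α x k) = Cd α 𝔣 x k / (Cd α 𝔣 x k + Cd α 𝔣 x (k - 1)) := by
  unfold Cd pOf
  rw [Vd_step _ k, Real.exp_add]
  have := Real.exp_pos (Vd (fun k => 𝔣 (pt α x k)) (k - 1))
  have := Real.exp_pos (𝔣 (pt α x k))
  field_simp
  ring

open Topology in
lemma Cd_right (α : ℝ) (hα : Irrational α) (𝔣 : UnitAddCircle → ℝ) (hc : Continuous 𝔣)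
    (h0 : ∫ z : UnitAddCircle, 𝔣 z = 0) (x : UnitAddCircle) (ε : ℝ) (hε : 0 < ε) :
    ∃ N : ℕ, Cd α 𝔣 x N ≤ ε * ∑ i ∈ range (N + 1), Cd α 𝔣 x i := by
  refine bdry (fun n : ℕ => Cd α 𝔣 x n) (fun n : ℕ => Vd (fun k => 𝔣 (pt α x k)) n) (fun n => rfl) ?_ ε hε
  refine (weyl_real α hα (x + (α : UnitAddCircle)) 𝔣 hc h0).congr fun n => ?_
  rw [Vd_nat]
  congr 1
  apply sum_congr rfl
  intro i _
  congr 1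
  unfold pt
  rw [add_assoc, ← AddCircle.coe_add]
  congr 2
  push_cast; ring

open Topology in
lemma Cd_left (α : ℝ) (hα : Irrational α) (𝔣 : UnitAddCircle → ℝ) (hc : Continuous 𝔣)
    (h0 : ∫ z : UnitAddCircle, 𝔣 z = 0) (x : UnitAddCircle) (ε : ℝ) (hε : 0 < ε) :
    ∃ N : ℕ, Cd α 𝔣 x (-1 - N) ≤ ε * ∑ i ∈ range (N + 1), Cd α 𝔣 x (-1 - i) := by
  refine bdry (fun n : ℕ => Cd α 𝔣 x (-1 - n)) (fun n : ℕ => Vd (fun k => 𝔣 (pt α x k)) (-1 - n)) (fun n => rfl) ?_ ε hε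
  have h1 := weyl_real (-α) hα.neg (x + ((-α : ℝ) : UnitAddCircle)) 𝔣 hc h0
  have h2 := (tendsto_one_div_atTop_nhds_zero_nat (𝕜 := ℝ)).const_mul (𝔣 (pt α x 0))
  have h3 := (h1.add h2).neg
  simp only [mul_zero, add_zero, neg_zero] at h3
  refine h3.congr fun n => ?_
  rw [Vd_neg, sum_range_succ', neg_div, add_div]
  congr 2
  · congr 1
    apply sum_congr rfl
    intro i _
    congr 1
    unfold pt
    rw [add_assoc, ← AddCircle.coe_add]
    congr 2
    push_cast; ring
  · simp [div_eq_mul_inv]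

lemma ratio_mono (u : ℕ → ℝ) (hu : ∀ n, 0 < u n) (hl : ∀ n, u (n + 1) ^ 2 ≤ u n * u (n + 2)) :
    Monotone (fun n => u (n + 1) / u n) := by
  apply monotone_nat_of_le_succ
  intro n
  rw [div_le_div_iff₀ (hu _) (hu _)]
  have := hl n
  nlinarith

lemma ratio_le_one (u : ℕ → ℝ) (hu : ∀ n, 0 < u n) (hu1 : ∀ n, u n ≤ 1) (hl : ∀ n, u (n + 1) ^ 2 ≤ u n * u (n + 2)) (m : ℕ) :
    u (m + 1) / u m ≤ 1 := by
  by_contra! hcon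
  set c := u (m + 1) / u m
  have hg : ∀ j, u m * c ^ j ≤ u (m + j) := by
    intro j
    induction j with
    | zero => simp
    | succ j ih =>
      have h1 : c ≤ u (m + j + 1) / u (m + j) := ratio_mono u hu hl (Nat.le_add_right m j)
      rw [le_div_iff₀ (hu _)] at h1
      rw [pow_succ, ← add_assoc]
      nlinarith
  obtain ⟨j, hj⟩ := pow_unbounded_of_one_lt (1 / u m) hcon
  have h1 := hg j
  have h2 := hu1 (m + j)
  rw [div_lt_iff₀ (hu m)] at hj
  linarith

lemma ratio_exists (u : ℕ → ℝ) (h00 : u 0 = 1) (hu : ∀ n, 0 < u n) 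
    (hnd : ∀ μ : ℝ, 0 < μ → μ < 1 → (∀ n, u n ≤ (μ ^ 4) ^ n) → False) (δ : ℝ) (hδ : 0 < δ) (hδ1 : δ < 1) :
    ∃ n, 1 - δ < u (n + 1) / u n := by
  by_contra! hcon
  have hb : ∀ n, u n ≤ (1 - δ) ^ n := by
    intro n
    induction n with
    | zero => simp [h00]
    | succ n ih =>
      have h1 := hcon n
      rw [div_le_iff₀ (hu n)] at h1
      rw [pow_succ]
      nlinarith
  have h1 : 0 < 1 - δ := by linarith
  refine hnd ((1 - δ) ^ ((1 : ℝ) / 4)) (by positivity) (Real.rpow_lt_one h1.le (by linarith) (by norm_num)) fun n => ?_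
  have : ((1 - δ) ^ ((1 : ℝ) / 4)) ^ 4 = 1 - δ := by
    rw [← Real.rpow_natCast, ← Real.rpow_mul h1.le]; norm_num
  rw [this]; exact hb n

/-- Lemma A.1: let `ζ_n = ξ_{2n}`. For every `ε > 0` and `r > 0`
there is `n₀` such that `1 - ε < ℙ_x(ζ_{n+j} = 0)/ℙ_x(ζ_n = 0) < 1 + ε` for every
`n ≥ n₀`, every `j ≤ r` and every `x ∈ 𝕋`. -/
theorem statement17 (α : ℝ) (hα : Irrational α) (𝔣 : UnitAddCircle → ℝ)
    (h𝔣 : ZeroMeanBV 𝔣) (ε : ℝ) (hε : 0 < ε) (r : ℕ) (hr : 0 < r) :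
    ∃ n₀ : ℕ, ∀ n : ℕ, n₀ ≤ n → ∀ j : ℕ, j ≤ r →
      ∀ (x : UnitAddCircle) (Ω : Type) [MeasurableSpace Ω] (ℙ : Measure Ω)
        (ξ : ℕ → Ω → ℤ), IsQPWalk (pOf 𝔣) α x 0 ℙ ξ →
        1 - ε < (ℙ {ω | ξ (2 * (n + j)) ω = 0}).toReal /
            (ℙ {ω | ξ (2 * n) ω = 0}).toReal ∧
          (ℙ {ω | ξ (2 * (n + j)) ω = 0}).toReal /
            (ℙ {ω | ξ (2 * n) ω = 0}).toReal < 1 + ε := by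
  obtain ⟨hc, -, h0⟩ := h𝔣
  have hpc : Continuous (pOf 𝔣) := by
    unfold pOf
    refine Continuous.div (by fun_prop) (by fun_prop) fun z => ?_
    have := Real.exp_pos (𝔣 z); positivity
  have hp0 : ∀ z, 0 < pOf 𝔣 z := fun z => by unfold pOf; positivity
  have hp1 : ∀ z, pOf 𝔣 z < 1 := fun z => by
    unfold pOf; rw [div_lt_one (by positivity)]; linarith
  have hbc : ∀ n k, Continuous fun x : UnitAddCircle => bk (fun k => pOf 𝔣 (pt α x k)) n k := by
    intro n
    induction n with
    | zero => intro k; simp only [bk]; exact continuous_const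
    | succ n ih =>
      intro k
      simp only [bk_succ]
      have hk : Continuous fun x : UnitAddCircle => pOf 𝔣 (pt α x k) := by
        unfold pt; exact hpc.comp (by fun_prop)
      exact (hk.mul (ih _)).add ((continuous_const.sub hk).mul (ih _))
  let u : UnitAddCircle → ℕ → ℝ := fun x n => bk (fun k => pOf 𝔣 (pt α x k)) (2 * n) 0
  have hu : ∀ x n, 0 < u x n := fun x n => bk_pos _ (fun _ => hp0 _) (fun _ => hp1 _) n
  have hu1 : ∀ x n, u x n ≤ 1 := fun x n => bk_le_one _ (fun _ => hp0 _) (fun _ => hp1 _) _ _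
  have hl : ∀ x n, u x (n + 1) ^ 2 ≤ u x n * u x (n + 2) := fun x n =>
    logconv (Cd α 𝔣 x) _ (Cd_pos α 𝔣 x) (Cd_p α 𝔣 x) n
  have hnd : ∀ x, ∀ μ : ℝ, 0 < μ → μ < 1 → (∀ n, u x n ≤ (μ ^ 4) ^ n) → False := fun x μ h1 h2 h3 =>
    no_decay (Cd α 𝔣 x) _ (Cd_pos α 𝔣 x) (Cd_p α 𝔣 x) (Cd_right α hα 𝔣 hc h0 x) (Cd_left α hα 𝔣 hc h0 x) μ h1 h2 h3
  obtain ⟨δ, hδ0, hδ1, hδr⟩ : ∃ δ : ℝ, 0 < δ ∧ δ < 1 ∧ r * δ < ε := by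
    have hr' : (0 : ℝ) < r := by exact_mod_cast hr
    refine ⟨min (1 / 2) (ε / (2 * r)), by positivity, lt_of_le_of_lt (min_le_left _ _) (by norm_num), ?_⟩
    calc r * min (1 / 2) (ε / (2 * r)) ≤ r * (ε / (2 * r)) := by gcongr; exact min_le_right _ _
      _ = ε / 2 := by field_simp
      _ < ε := by linarith
  let U : ℕ → Set UnitAddCircle := fun n => {x | 1 - δ < u x (n + 1) / u x n}
  have hUo : ∀ n, IsOpen (U n) := fun n =>
    isOpen_lt continuous_const ((hbc _ _).div (hbc _ _) fun x => (hu x n).ne')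
  have hUm : Monotone U := fun m n hmn x hx => lt_of_lt_of_le hx (ratio_mono (u x) (hu x) (hl x) hmn)
  obtain ⟨N, hN⟩ := isCompact_univ.elim_directed_cover U hUo (fun x _ => Set.mem_iUnion.2
    (ratio_exists (u x) (by simp [u, bk]) (hu x) (hnd x) δ hδ0 hδ1)) hUm.directed_le
  refine ⟨N, fun n hn j hj x Ω _ ℙ ξ hξ => ?_⟩
  have hP : ∀ n, (ℙ {ω | ξ (2 * n) ω = 0}).toReal = u x n := by
    intro n
    rw [walk_prob hξ (fun z => (hp0 z).le) (fun z => (hp1 z).le) (Cd α 𝔣 x) (Cd_pos α 𝔣 x) (Cd_p α 𝔣 x),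
      div_self (add_pos (Cd_pos _ _ _ _) (Cd_pos _ _ _ _)).ne', one_mul]
  rw [hP, hP]
  have hlow : ∀ j : ℕ, (1 - δ) ^ j * u x n ≤ u x (n + j) ∧ u x (n + j) ≤ u x n := by
    intro j
    induction j with
    | zero => simp
    | succ j ih =>
      have h1 : 1 - δ < u x (n + j + 1) / u x (n + j) := hUm (show N ≤ n + j by omega) (hN (Set.mem_univ x))
      have h2 := ratio_le_one (u x) (hu x) (hu1 x) (hl x) (n + j)
      rw [lt_div_iff₀ (hu _ _)] at h1
      rw [div_le_one (hu _ _)] at h2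
      rw [← add_assoc, pow_succ]
      refine ⟨?_, h2.trans ih.2⟩
      nlinarith [ih.1]
  obtain ⟨h1, h2⟩ := hlow j
  have hB : 1 - ε < (1 - δ) ^ j := by
    have := one_add_mul_le_pow (show (-2 : ℝ) ≤ -δ by linarith) j
    have hj' : (j : ℝ) ≤ r := by exact_mod_cast hj
    rw [← sub_eq_add_neg] at this
    nlinarith
  rw [lt_div_iff₀ (hu _ _), div_lt_iff₀ (hu _ _)]
  have := hu x n
  constructor <;> nlinarith
end
end

section
/- Let 𝔣 be continuous of bounded variation with ∫_𝕋 𝔣(x) dx = 0, let 𝔭(x) = e^{𝔣(x)}/(1+e^{𝔣(x)}), and set ζ_n = ξ_{2n}. Then for every ε > 0 and every integer q ≥ 2 there exists n₀ such that Σ_{k=n₀+1}^∞ ℙ_x(ζ_1 ≠ 0, ζ_2 ≠ 0, …, ζ_{k−1} ≠ 0, ζ_k = a) < ε for every x ∈ 𝕋 and every integer a with |a| ≤ q. -/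
open MeasureTheory Filter Finset

noncomputable section

attribute [local instance] Classical.propDecidable

lemma bv_aux (f : UnitAddCircle → ℝ)
    (h : BoundedVariationOn (fun t : ℝ => f (t : UnitAddCircle)) (Set.Icc 0 1)) :
    ∃ v : ℝ → ℝ, MonotoneOn v (Set.Icc 0 3) ∧ ∀ a ∈ Set.Icc (0:ℝ) 3, ∀ b ∈ Set.Icc (0:ℝ) 3, a ≤ b →
      |f (b : UnitAddCircle) - f (a : UnitAddCircle)| ≤ v b - v a := by
  set F : ℝ → ℝ := fun t => f (t : UnitAddCircle) with hF
  have hper : ∀ n : ℕ, eVariationOn F (Set.Icc (n:ℝ) (n+1)) ≤ eVariationOn F (Set.Icc 0 1) := by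
    intro n
    have h1 : F = F ∘ (fun t => t - (n:ℝ)) := by
      funext t
      simp only [hF, Function.comp]
      congr 1
      have : ((n:ℝ) : UnitAddCircle) = 0 := by
        rw [AddCircle.coe_eq_zero_iff]; exact ⟨n, by simp⟩
      rw [AddCircle.coe_sub, this, sub_zero]
    calc eVariationOn F (Set.Icc (n:ℝ) (n+1)) 
        = eVariationOn (F ∘ (fun t => t - (n:ℝ))) (Set.Icc (n:ℝ) (n+1)) := by rw [← h1]
      _ ≤ _ := by
        apply eVariationOn.comp_le_of_monotoneOn
        · intro a _ b _ hab; simpa using hab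
        · intro a ha; simp only [Set.mem_Icc] at ha ⊢; constructor <;> linarith [ha.1, ha.2]
  have hn : ∀ n : ℕ, eVariationOn F (Set.Icc (n:ℝ) (n+1)) ≠ ⊤ := fun n =>
    ne_top_of_le_ne_top h (hper n)
  have h3 : BoundedVariationOn F (Set.Icc 0 3) := by
    have e1 := eVariationOn.Icc_add_Icc F (s := Set.univ) (a := 0) (b := 1) (c := 2) (by norm_num) (by norm_num) (by simp)
    have e2 := eVariationOn.Icc_add_Icc F (s := Set.univ) (a := 0) (b := 2) (c := 3) (by norm_num) (by norm_num) (by simp)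
    simp only [Set.univ_inter] at e1 e2
    unfold BoundedVariationOn
    rw [← e2, ← e1]
    have a0 := hn 0
    have a1 := hn 1
    have a2 := hn 2
    norm_num at a0 a1 a2
    simp [a0, a1, a2]
  obtain ⟨p, q, hp, hq, hpq⟩ := h3.locallyBoundedVariationOn.exists_monotoneOn_sub_monotoneOn
  refine ⟨p + q, hp.add hq, ?_⟩
  intro a ha b hb hab
  have : ∀ t : ℝ, f (t : UnitAddCircle) = p t - q t := fun t => congrFun hpq t
  rw [this, this, abs_le]
  have := hp ha hb hab
  have := hq ha hb hab
  simp only [Pi.add_apply]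
  constructor <;> linarith

lemma exists_zero_aux (f : UnitAddCircle → ℝ) (hc : Continuous f) (h0 : ∫ z, f z = 0)
    (q : ℕ) (hq : 0 < q) (x : ℝ) :
    ∃ t ∈ Set.Ico (0:ℝ) (1/q), ∑ j ∈ range q, f ((x + j / q + t : ℝ) : UnitAddCircle) = 0 := by
  set H : UnitAddCircle → ℝ := fun y => ∑ j ∈ range q, f (y + ((x + j / q : ℝ) : UnitAddCircle)) with hH
  have hHc : Continuous H := by
    apply continuous_finsetSum; intro j _; exact hc.comp (by fun_prop)
  have hint : ∀ g : UnitAddCircle → ℝ, Continuous g → Integrable g := by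
    intro g hg
    exact hg.integrable_of_hasCompactSupport (HasCompactSupport.of_compactSpace g)
  have hHi : ∫ y, H y = 0 := by
    simp only [hH]
    rw [integral_finsetSum]
    · apply Finset.sum_eq_zero; intro j _
      rw [integral_add_right_eq_self, h0]
    · intro j _; exact hint _ (hc.comp (by fun_prop))
  have hz : ∃ y, H y = 0 := by
    by_contra hne
    push Not at hne
    have key : ∀ g : UnitAddCircle → ℝ, Continuous g → (∀ y, 0 < g y) → 0 < ∫ y, g y := by
      intro g hg hpos
      rw [integral_pos_iff_support_of_nonneg (fun y => (hpos y).le) (hint g hg)]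
      have : Function.support g = Set.univ := by
        ext y; simp [(hpos y).ne']
      rw [this]; simp
    have hconn : (∀ y, 0 < H y) ∨ (∀ y, H y < 0) := by
      by_contra hcon
      push Not at hcon
      obtain ⟨⟨a, ha⟩, ⟨b, hb⟩⟩ := hcon
      obtain ⟨y, hy⟩ := mem_range_of_exists_le_of_exists_ge hHc ⟨a, ha⟩ ⟨b, hb⟩
      exact hne y hy
    rcases hconn with hp | hn
    · exact absurd hHi (key H hHc hp).ne'
    · have := key (fun y => - H y) hHc.neg (fun y => by linarith [hn y])
      rw [integral_neg, hHi] at this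
      simp at this
  obtain ⟨y, hy⟩ := hz
  obtain ⟨s, rfl⟩ := QuotientAddGroup.mk_surjective y
  have hq' : (0:ℝ) < q := by exact_mod_cast hq
  set G : ℝ → ℝ := fun t => ∑ j ∈ range q, f ((x + j / q + t : ℝ) : UnitAddCircle) with hG
  have hper : Function.Periodic G (1/q : ℝ) := by
    intro t
    simp only [hG]
    have e : ∀ j : ℕ, f ((x + j / q + (t + 1 / q) : ℝ) : UnitAddCircle) =
        (fun i : ℕ => f ((x + i / q + t : ℝ) : UnitAddCircle)) (j + 1) := by
      intro j; simp only; congr 2; push_cast; ring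
    rw [Finset.sum_congr rfl (fun j _ => e j)]
    have h1 := Finset.sum_range_succ (fun i : ℕ => f ((x + i / q + t : ℝ) : UnitAddCircle)) q
    have h2 := Finset.sum_range_succ' (fun i : ℕ => f ((x + i / q + t : ℝ) : UnitAddCircle)) q
    have h3 : f ((x + (q:ℕ) / q + t : ℝ) : UnitAddCircle) = f ((x + (0:ℕ) / q + t : ℝ) : UnitAddCircle) := by
      have : (x + (q:ℕ) / q + t : ℝ) = (x + (0:ℕ) / q + t : ℝ) + 1 := by
        rw [div_self hq'.ne']; simp; ring
      rw [this, AddCircle.coe_add]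
      have : ((1:ℝ) : UnitAddCircle) = 0 := AddCircle.coe_period 1
      rw [this, add_zero]
    linarith
  obtain ⟨t, ht, hst⟩ := hper.exists_mem_Ico₀ (by positivity) s
  refine ⟨t, ht, ?_⟩
  change G t = 0
  rw [← hst, ← hy]
  simp only [hG, hH]
  apply Finset.sum_congr rfl; intro j _
  congr 1
  change _ = ((s:ℝ) : UnitAddCircle) + _
  rw [← AddCircle.coe_add]; congr 1; ring

lemma dk_aux (α : ℝ) (f : UnitAddCircle → ℝ) (hf : ZeroMeanBV f) :
    ∃ C : ℝ, ∀ r : ℚ, |α - r| < 1 / (r.den : ℝ)^2 → ∀ x : UnitAddCircle,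
      |∑ k ∈ range r.den, f (pt α x k)| ≤ C := by
  obtain ⟨hc, hbv, h0⟩ := hf
  obtain ⟨v, hv, hfv⟩ := bv_aux f hbv
  refine ⟨2 * (v 3 - v 0), ?_⟩
  intro r hr x
  set q := r.den with hqdef
  have hq : 0 < q := r.den_pos
  have hq' : (0:ℝ) < q := by exact_mod_cast hq
  have hq1 : (1:ℝ) / q ≤ 1 := by
    rw [div_le_one hq']; exact_mod_cast hq
  obtain ⟨X, hX, rfl⟩ : ∃ X : ℝ, X ∈ Set.Ico (1:ℝ) 2 ∧ (X : UnitAddCircle) = x := by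
    obtain ⟨s, rfl⟩ := QuotientAddGroup.mk_surjective x
    refine ⟨Int.fract s + 1, ⟨by linarith [Int.fract_nonneg s], by linarith [Int.fract_lt_one s]⟩, ?_⟩
    rw [AddCircle.coe_add]
    have : ((1:ℝ) : UnitAddCircle) = 0 := AddCircle.coe_period 1
    rw [this, add_zero]
    change _ = ((s:ℝ) : UnitAddCircle)
    conv_rhs => rw [← Int.floor_add_fract s]
    rw [AddCircle.coe_add]
    have : (((⌊s⌋:ℤ):ℝ) : UnitAddCircle) = 0 := by
      rw [AddCircle.coe_eq_zero_iff]; exact ⟨⌊s⌋, by simp⟩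
    rw [this, zero_add]
  obtain ⟨t, ht, hz⟩ := exists_zero_aux f hc h0 q hq X
  -- permutation
  set σ : ℕ → ℕ := fun k => ((k * r.num) % (q:ℤ)).toNat with hσ
  have hqz : (0:ℤ) < q := by exact_mod_cast hq
  have hσc : ∀ k, ((σ k : ℕ) : ℤ) = (k * r.num) % (q:ℤ) := fun k =>
    Int.toNat_of_nonneg (Int.emod_nonneg _ hqz.ne')
  have hmaps : Set.MapsTo σ (range q) (range q) := by
    intro k _
    simp only [coe_range, Set.mem_Iio]
    have := Int.emod_lt_of_pos (k * r.num) hqz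
    rw [← hσc] at this
    exact_mod_cast this
  have hinj : Set.InjOn σ (range q) := by
    intro k hk l hl hkl
    simp only [coe_range, Set.mem_Iio] at hk hl
    have h1 : ((k * r.num) % (q:ℤ)) = (l * r.num) % (q:ℤ) := by rw [← hσc, ← hσc, hkl]
    have h2 : (q:ℤ) ∣ (k * r.num - l * r.num) := Int.ModEq.dvd (n := (q:ℤ)) h1.symm
    rw [← sub_mul] at h2
    have hcop : IsCoprime (q:ℤ) r.num := by
      rw [Int.isCoprime_iff_nat_coprime]
      simpa using r.reduced.symm
    have h3 := hcop.dvd_of_dvd_mul_right h2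
    have h4 : |(k:ℤ) - l| < q := by rw [abs_lt]; constructor <;> omega
    have h5 := Int.eq_zero_of_abs_lt_dvd h3 h4
    omega
  have hsum : ∀ g : ℕ → ℝ, ∑ k ∈ range q, g (σ k) = ∑ j ∈ range q, g j := by
    intro g
    have himg : (range q).image σ = range q :=
      Finset.eq_of_subset_of_card_le (Finset.image_subset_iff.2 (fun k hk => by simpa using hmaps (by simpa using hk)))
        (by rw [Finset.card_image_of_injOn hinj])
    conv_rhs => rw [← himg]
    rw [Finset.sum_image hinj]
  have hterm : ∀ k ∈ range q, |f (pt α X k) - f ((X + (σ k : ℕ) / q + t : ℝ) : UnitAddCircle)| ≤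
      v (X + ((σ k : ℕ) + 1) / q) - v (X + ((σ k : ℕ) - 1) / q) := by
    intro k hk
    have hkq : k < q := by simpa using hk
    have hjq : σ k < q := by simpa using hmaps (by simpa using hk)
    set δ : ℝ := k * (α - r) with hδ
    have hδ' : |δ| ≤ 1 / q := by
      rw [hδ, abs_mul, Nat.abs_cast]
      calc (k:ℝ) * |α - r| ≤ q * (1 / (q:ℝ)^2) := by
            apply mul_le_mul (by exact_mod_cast hkq.le) hr.le (abs_nonneg _) hq'.le
        _ = 1 / q := by field_simp
    have hpt : pt α X k = ((X + (σ k : ℕ) / q + δ : ℝ) : UnitAddCircle) := by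
      unfold pt
      rw [← AddCircle.coe_add]
      have hr2 : (r:ℝ) * q = r.num := by exact_mod_cast Rat.mul_den_eq_num r
      have hdm : (k * r.num : ℤ) = q * ((k * r.num) / (q:ℤ)) + (σ k : ℕ) := by
        rw [hσc]; exact (Int.mul_ediv_add_emod _ _).symm
      have hdm' : (k * r.num : ℝ) = q * (((k * r.num) / (q:ℤ) : ℤ) : ℝ) + (σ k : ℕ) := by
        exact_mod_cast hdm
      set M : ℤ := (k * r.num) / (q:ℤ)
      have hM : ((M : ℝ) : UnitAddCircle) = 0 := by
        rw [AddCircle.coe_eq_zero_iff]; exact ⟨M, by simp⟩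
      have : X + ((k:ℤ):ℝ) * α = (X + (σ k : ℕ) / q + δ) + M := by
        rw [hδ]
        have : (r:ℝ) = r.num / q := by rw [← hr2]; field_simp
        rw [this]
        have h7 : ((σ k : ℕ) : ℝ) = k * r.num - q * M := by linarith
        rw [h7]; push_cast; field_simp; ring
      rw [this, AddCircle.coe_add _ _ (M:ℝ), hM, add_zero]
    rw [hpt]
    obtain ⟨hδ1, hδ2⟩ := abs_le.1 hδ'
    obtain ⟨ht1, ht2⟩ := ht
    have hj0 : (0:ℝ) ≤ (σ k : ℕ) / q := by positivity
    have hj1 : ((σ k : ℕ) + 1 : ℝ) / q ≤ 1 := by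
      rw [div_le_one hq']; exact_mod_cast hjq
    have hX1 := hX.1
    have hX2 := hX.2
    rw [add_div] at hj1 ⊢
    rw [sub_div]
    have hi : (0:ℝ) < 1/q := by positivity
    have m1 : X + ((σ k : ℕ) / q - 1 / q) ∈ Set.Icc (0:ℝ) 3 := ⟨by linarith, by linarith⟩
    have m2 : X + ((σ k : ℕ) / q + 1 / q) ∈ Set.Icc (0:ℝ) 3 := ⟨by linarith, by linarith⟩
    have m3 : X + (σ k : ℕ) / q + δ ∈ Set.Icc (0:ℝ) 3 := ⟨by linarith, by linarith⟩
    have m4 : X + (σ k : ℕ) / q + t ∈ Set.Icc (0:ℝ) 3 := ⟨by linarith, by linarith⟩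
    have := hv m1 m3 (by linarith)
    have := hv m1 m4 (by linarith)
    have := hv m3 m2 (by linarith)
    have := hv m4 m2 (by linarith)
    rcases le_total δ t with h | h
    · have := hfv _ m3 _ m4 (by linarith)
      rw [abs_sub_comm]; linarith
    · have := hfv _ m4 _ m3 (by linarith)
      linarith
  have htel : ∑ j ∈ range q, (v (X + ((j : ℕ) + 1) / q) - v (X + ((j : ℕ) - 1) / q)) ≤ 2 * (v 3 - v 0) := by
    have e : ∀ j ∈ range q, (v (X + ((j : ℕ) + 1) / q) - v (X + ((j : ℕ) - 1) / q)) =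
      ((fun i : ℕ => v (X + i / q) + v (X + ((i:ℝ) - 1) / q)) (j + 1) - (fun i : ℕ => v (X + i / q) + v (X + ((i:ℝ) - 1) / q)) j) := by
      intro j _
      simp only; push_cast
      rw [add_sub_cancel_right]; ring
    rw [Finset.sum_congr rfl e,
      Finset.sum_range_sub (fun i : ℕ => v (X + i / q) + v (X + ((i:ℝ) - 1) / q))]
    rw [div_self hq'.ne', sub_div, div_self hq'.ne']
    have hX1 := hX.1
    have hX2 := hX.2
    have hi : (0:ℝ) < 1/q := by positivity
    have z0 : (0:ℝ) ∈ Set.Icc (0:ℝ) 3 := by norm_num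
    have z3 : (3:ℝ) ∈ Set.Icc (0:ℝ) 3 := by norm_num
    have hb : ∀ s ∈ Set.Icc (0:ℝ) 3, v 0 ≤ v s ∧ v s ≤ v 3 := fun s hs =>
      ⟨hv z0 hs hs.1, hv hs z3 hs.2⟩
    have b1 := hb (X + 1) ⟨by linarith, by linarith⟩
    have b2 := hb (X + (1 - 1 / q)) ⟨by linarith, by linarith⟩
    have b3 := hb (X + (0:ℕ) / q) ⟨by simp; linarith, by simp; linarith⟩
    have b4 := hb (X + ((0:ℕ) - 1) / q) (by
      have : ((0:ℕ) - 1 : ℝ) / q = - (1 / q) := by simp; ring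
      rw [this]
      exact ⟨by linarith, by linarith⟩)
    linarith [b1.2, b2.2, b3.1, b4.1]
  rw [← hsum (fun j => f ((X + j / q + t : ℝ) : UnitAddCircle))] at hz
  rw [← hsum (fun j => (v (X + ((j : ℕ) + 1) / q) - v (X + ((j : ℕ) - 1) / q)))] at htel
  calc |∑ k ∈ range q, f (pt α X k)|
      = |∑ k ∈ range q, (f (pt α X k) - f ((X + (σ k : ℕ) / q + t : ℝ) : UnitAddCircle))| := by
        rw [Finset.sum_sub_distrib, hz, sub_zero]
    _ ≤ ∑ k ∈ range q, |f (pt α X k) - f ((X + (σ k : ℕ) / q + t : ℝ) : UnitAddCircle)| :=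
        Finset.abs_sum_le_sum_abs _ _
    _ ≤ _ := (Finset.sum_le_sum hterm).trans htel

lemma dk (α : ℝ) (hα : Irrational α) (f : UnitAddCircle → ℝ) (hf : ZeroMeanBV f) :
    ∃ C : ℝ, ∀ N : ℕ, ∃ n ≥ N, ∀ x : UnitAddCircle, |∑ k ∈ range n, f (pt α x k)| ≤ C := by
  obtain ⟨C, hC⟩ := dk_aux α f hf
  refine ⟨C, fun N => ?_⟩
  by_contra hcon
  push Not at hcon
  have hinf := Real.infinite_rat_abs_sub_lt_one_div_den_sq_of_irrational hα
  apply hinf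
  have hsub : {r : ℚ | |α - r| < 1 / (r.den : ℝ)^2} ⊆
      ⋃ d ∈ Set.Iio N, ((fun m : ℤ => (m / (d:ℕ) : ℚ)) '' (Set.Icc (⌊-(|α| + 1) * d⌋) (⌈(|α|+1) * d⌉))) := by
    intro r hr
    have hlt : r.den < N := by
      by_contra h
      push Not at h
      obtain ⟨x, hx⟩ := hcon r.den h
      exact absurd (hC r hr x) (not_le.2 hx)
    simp only [Set.mem_iUnion]
    refine ⟨r.den, hlt, r.num, ?_, r.num_div_den⟩
    have hd : (0:ℝ) < r.den := by exact_mod_cast r.den_pos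
    have hd1 : (1:ℝ) ≤ r.den := by exact_mod_cast r.den_pos
    have h1 : 1 / (r.den : ℝ)^2 ≤ 1 := by
      rw [div_le_one (by positivity)]; nlinarith
    have h2 : |α - r| ≤ 1 := le_trans (le_of_lt hr) h1
    have h3 : (r:ℝ) * r.den = r.num := by exact_mod_cast Rat.mul_den_eq_num r
    have h4 := abs_le.1 h2
    have h5 := le_abs_self α
    have h6 := neg_abs_le α
    constructor
    · have : ((⌊-(|α| + 1) * (r.den:ℝ)⌋ : ℤ) : ℝ) ≤ r.num := by
        refine (Int.floor_le _).trans ?_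
        rw [← h3]
        apply mul_le_mul_of_nonneg_right _ hd.le
        linarith
      exact_mod_cast this
    · have : (r.num : ℝ) ≤ ((⌈(|α| + 1) * (r.den:ℝ)⌉ : ℤ) : ℝ) := by
        refine le_trans ?_ (Int.le_ceil _)
        rw [← h3]
        apply mul_le_mul_of_nonneg_right _ hd.le
        linarith
      exact_mod_cast this
  refine Set.Finite.subset ?_ hsub
  apply Set.Finite.biUnion (Set.finite_Iio N)
  intro d _
  exact (Set.finite_Icc _ _).image _

/-- Probability of not visiting `0` at times `1..n` starting from `j`. -/
def survU (p : UnitAddCircle → ℝ) (α : ℝ) (x : UnitAddCircle) : ℕ → ℤ → ℝ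
  | 0, _ => 1
  | n + 1, j => p (pt α x j) * (if j + 1 = 0 then 0 else survU p α x n (j + 1)) +
      (1 - p (pt α x j)) * (if j - 1 = 0 then 0 else survU p α x n (j - 1))

lemma survU_mem (p : UnitAddCircle → ℝ) (hp : ∀ z, 0 ≤ p z ∧ p z ≤ 1) (α : ℝ) (x : UnitAddCircle)
    (n : ℕ) : ∀ j, 0 ≤ survU p α x n j ∧ survU p α x n j ≤ 1 := by
  induction n with
  | zero => intro j; simp [survU]
  | succ n ih =>
    intro j
    obtain ⟨h1, h2⟩ := hp (pt α x j)
    have a : 0 ≤ (if j + 1 = 0 then 0 else survU p α x n (j + 1)) ∧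
        (if j + 1 = 0 then 0 else survU p α x n (j + 1)) ≤ 1 := by
      split_ifs
      · simp
      · exact ih _
    have b : 0 ≤ (if j - 1 = 0 then 0 else survU p α x n (j - 1)) ∧
        (if j - 1 = 0 then 0 else survU p α x n (j - 1)) ≤ 1 := by
      split_ifs
      · simp
      · exact ih _
    simp only [survU]
    constructor
    · have := mul_nonneg h1 a.1
      have := mul_nonneg (sub_nonneg.2 h2) b.1
      linarith
    · have := mul_le_mul_of_nonneg_left a.2 h1
      have := mul_le_mul_of_nonneg_left b.2 (sub_nonneg.2 h2)
      linarith

lemma survU_succ_le (p : UnitAddCircle → ℝ) (hp : ∀ z, 0 ≤ p z ∧ p z ≤ 1) (α : ℝ)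
    (x : UnitAddCircle) (n : ℕ) : ∀ j, survU p α x (n + 1) j ≤ survU p α x n j := by
  induction n with
  | zero => intro j; exact (survU_mem p hp α x 1 j).2
  | succ n ih =>
    intro j
    obtain ⟨h1, h2⟩ := hp (pt α x j)
    change _ * (if j + 1 = 0 then 0 else survU p α x (n + 1) (j + 1)) +
      _ * (if j - 1 = 0 then 0 else survU p α x (n + 1) (j - 1)) ≤
      _ * (if j + 1 = 0 then 0 else survU p α x n (j + 1)) +
      _ * (if j - 1 = 0 then 0 else survU p α x n (j - 1))
    apply add_le_add
    · apply mul_le_mul_of_nonneg_left _ h1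
      split_ifs
      · exact le_rfl
      · exact ih _
    · apply mul_le_mul_of_nonneg_left _ (sub_nonneg.2 h2)
      split_ifs
      · exact le_rfl
      · exact ih _

lemma survU_cont (p : UnitAddCircle → ℝ) (hp : Continuous p) (α : ℝ) (n : ℕ) :
    ∀ j, Continuous (fun x => survU p α x n j) := by
  induction n with
  | zero => intro j; simp only [survU]; exact continuous_const
  | succ n ih =>
    intro j
    have hpt : Continuous (fun x => p (pt α x j)) := hp.comp (by unfold pt; fun_prop)
    simp only [survU]
    apply Continuous.add
    · apply hpt.mul
      split_ifs
      · exact continuous_const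
      · exact ih _
    · apply (continuous_const.sub hpt).mul
      split_ifs
      · exact continuous_const
      · exact ih _

lemma side_zero (V s : ℕ → ℝ) (h0 : V 0 = 0) (hV : ∀ n, 0 ≤ V n ∧ V n ≤ 1)
    (hrec : ∀ n, V (n + 2) - V (n + 1) = Real.exp (- s n) * (V (n + 1) - V n))
    (C : ℝ) (hC : ∀ N : ℕ, ∃ n ≥ N, ∑ k ∈ range n, s k ≤ C) : V 1 = 0 := by
  have hinc : ∀ n, V (n + 1) - V n = Real.exp (- ∑ k ∈ range n, s k) * V 1 := by
    intro n
    induction n with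
    | zero => simp [h0]
    | succ n ih =>
      rw [hrec, ih, Finset.sum_range_succ, neg_add, Real.exp_add]; ring
  by_contra hne
  have hpos : 0 < V 1 := lt_of_le_of_ne (hV 1).1 (Ne.symm hne)
  have hmono : Monotone V := monotone_nat_of_le_succ (fun n => by
    have := hinc n
    have : 0 < Real.exp (- ∑ k ∈ range n, s k) * V 1 := by positivity
    linarith)
  have hlim := tendsto_atTop_ciSup hmono ⟨1, by rintro _ ⟨n, rfl⟩; exact (hV n).2⟩
  have hd : Tendsto (fun n => V (n + 1) - V n) atTop (nhds 0) := by
    have := (hlim.comp (tendsto_add_atTop_nat 1)).sub hlim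
    simpa using this
  have hc : 0 < Real.exp (-C) * V 1 := by positivity
  obtain ⟨N, hN⟩ := eventually_atTop.1 (hd.eventually (gt_mem_nhds hc))
  obtain ⟨n, hn, hS⟩ := hC N
  have h1 := hN n hn
  rw [hinc] at h1
  have : Real.exp (-C) ≤ Real.exp (- ∑ k ∈ range n, s k) := Real.exp_le_exp.2 (by linarith)
  have := mul_le_mul_of_nonneg_right this hpos.le
  linarith

lemma pOf_mem (f : UnitAddCircle → ℝ) (z : UnitAddCircle) : 0 < pOf f z ∧ pOf f z < 1 := by
  unfold pOf
  have := Real.exp_pos (f z)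
  constructor
  · positivity
  · rw [div_lt_one (by positivity)]; linarith

lemma pOf_cont (f : UnitAddCircle → ℝ) (hf : Continuous f) : Continuous (pOf f) := by
  unfold pOf
  apply Continuous.div (by fun_prop) (by fun_prop)
  intro z
  have := Real.exp_pos (f z)
  positivity

lemma pOf_rec (f : UnitAddCircle → ℝ) (z : UnitAddCircle) (a b c : ℝ)
    (h : b = pOf f z * c + (1 - pOf f z) * a) :
    c - b = Real.exp (- f z) * (b - a) ∧ a - b = Real.exp (f z) * (b - c) := by
  have he := Real.exp_pos (f z)
  have h1 : pOf f z * (1 + Real.exp (f z)) = Real.exp (f z) := by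
    unfold pOf; field_simp
  have h2 : b * (1 + Real.exp (f z)) = Real.exp (f z) * c + a := by
    rw [h]; linear_combination (c - a) * h1
  constructor
  · rw [Real.exp_neg]; field_simp; linear_combination -h2
  · linear_combination -h2

lemma survU_tendsto (α : ℝ) (hα : Irrational α) (f : UnitAddCircle → ℝ) (hf : ZeroMeanBV f)
    (x : UnitAddCircle) : Tendsto (fun n => survU (pOf f) α x n 0) atTop (nhds 0) := by
  have hp : ∀ z, 0 ≤ pOf f z ∧ pOf f z ≤ 1 := fun z => ⟨(pOf_mem f z).1.le, (pOf_mem f z).2.le⟩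
  set L : ℤ → ℝ := fun j => ⨅ n, survU (pOf f) α x n j with hL
  have hlim : ∀ j, Tendsto (fun n => survU (pOf f) α x n j) atTop (nhds (L j)) := fun j =>
    tendsto_atTop_ciInf (antitone_nat_of_succ_le (fun n => survU_succ_le _ hp α x n j))
      ⟨0, by rintro _ ⟨n, rfl⟩; exact (survU_mem _ hp α x n j).1⟩
  set V : ℤ → ℝ := fun j => if j = 0 then 0 else L j with hV
  have hVlim : ∀ j, Tendsto (fun n => if j = 0 then 0 else survU (pOf f) α x n j) atTop (nhds (V j)) := by
    intro j
    by_cases hj : j = 0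
    · simp [hV, hj]
    · simpa [hV, hj] using hlim j
  have hLrec : ∀ j, L j = pOf f (pt α x j) * V (j + 1) + (1 - pOf f (pt α x j)) * V (j - 1) := by
    intro j
    refine tendsto_nhds_unique ((hlim j).comp (tendsto_add_atTop_nat 1)) ?_
    exact ((hVlim (j+1)).const_mul _).add ((hVlim (j-1)).const_mul _)
  have hV01 : ∀ j, 0 ≤ V j ∧ V j ≤ 1 := by
    intro j
    by_cases hj : j = 0
    · simp [hV, hj]
    · simp only [hV, hj, if_false]
      exact ⟨ge_of_tendsto' (hlim j) (fun n => (survU_mem _ hp α x n j).1),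
        le_of_tendsto' (hlim j) (fun n => (survU_mem _ hp α x n j).2)⟩
  have hVrec : ∀ j, j ≠ 0 → V j = pOf f (pt α x j) * V (j + 1) + (1 - pOf f (pt α x j)) * V (j - 1) := by
    intro j hj
    rw [← hLrec]; simp [hV, hj]
  have hp1 : V 1 = 0 := by
    obtain ⟨C, hC⟩ := dk α hα f hf
    have := side_zero (fun n => V n) (fun k => f (pt α x (k + 1))) (by simp [hV]) (fun n => hV01 n) ?_ C ?_
    · simpa using this
    · intro n
      have := (pOf_rec f _ _ _ _ (hVrec (n + 1) (by omega))).1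
      rw [show (n:ℤ) + 1 + 1 = n + 2 by ring, show (n:ℤ) + 1 - 1 = n by ring] at this
      simpa using this
    · intro N
      obtain ⟨n, hn, h⟩ := hC N
      refine ⟨n, hn, ?_⟩
      have := (abs_le.1 (h (x + ((α:ℝ) : UnitAddCircle)))).2
      refine le_trans (le_of_eq ?_) this
      apply Finset.sum_congr rfl; intro k _
      congr 1
      unfold pt
      rw [add_assoc, ← AddCircle.coe_add]
      congr 2; push_cast; ring
  have hm1 : V (-1) = 0 := by
    obtain ⟨C, hC⟩ := dk (-α) hα.neg f hf
    have := side_zero (fun n => V (-n)) (fun k => - f (pt α x (-(k + 1)))) (by simp [hV]) (fun n => hV01 _) ?_ C ?_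
    · simpa using this
    · intro n
      have := (pOf_rec f _ _ _ _ (hVrec (-(n + 1)) (by omega))).2
      rw [show -((n:ℤ) + 1) + 1 = -n by ring, show -((n:ℤ) + 1) - 1 = -(n+2) by ring] at this
      rw [neg_neg]
      push_cast
      exact this
    · intro N
      obtain ⟨n, hn, h⟩ := hC N
      refine ⟨n, hn, ?_⟩
      have := (abs_le.1 (h (x + ((-α:ℝ) : UnitAddCircle)))).1
      have e : ∑ k ∈ range n, f (pt α x (-((k:ℤ) + 1))) = ∑ k ∈ range n, f (pt (-α) (x + ((-α:ℝ) : UnitAddCircle)) k) := by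
        apply Finset.sum_congr rfl; intro k _
        congr 1
        unfold pt
        rw [add_assoc, ← AddCircle.coe_add]
        congr 2; push_cast; ring
      rw [Finset.sum_neg_distrib, e]; linarith
  have : L 0 = 0 := by rw [hLrec 0]; simp [hp1, hm1]
  rw [← this]; exact hlim 0

lemma survU_unif (α : ℝ) (hα : Irrational α) (f : UnitAddCircle → ℝ) (hf : ZeroMeanBV f)
    (δ : ℝ) (hδ : 0 < δ) : ∃ N, ∀ n ≥ N, ∀ x, survU (pOf f) α x n 0 < δ := by
  have hp : ∀ z, 0 ≤ pOf f z ∧ pOf f z ≤ 1 := fun z => ⟨(pOf_mem f z).1.le, (pOf_mem f z).2.le⟩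
  have := Antitone.tendstoUniformly_of_forall_tendsto (F := fun n x => survU (pOf f) α x n 0)
    (f := fun _ => (0:ℝ)) (fun n => survU_cont _ (pOf_cont f hf.1) α n 0)
    (antitone_nat_of_succ_le (fun n x => survU_succ_le _ hp α x n 0)) continuous_const
    (survU_tendsto α hα f hf)
  rw [Metric.tendstoUniformly_iff] at this
  obtain ⟨N, hN⟩ := eventually_atTop.1 (this δ hδ)
  refine ⟨N, fun n hn x => ?_⟩
  have := hN n hn x
  rw [dist_comm, Real.dist_eq, sub_zero] at this
  exact (le_abs_self _).trans_lt this

section walk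
variable {Ω : Type} [MeasurableSpace Ω]

/-- `E` depends only on the path up to time `n`. -/
def DetBy (ξ : ℕ → Ω → ℤ) (n : ℕ) (E : Set Ω) : Prop :=
  ∀ ω ω', (∀ i ≤ n, ξ i ω = ξ i ω') → ω ∈ E → ω' ∈ E

lemma meas_part {κ : Type} [Countable κ] [MeasurableSpace κ] [MeasurableSingletonClass κ]
    (μ : Measure Ω) (g : Ω → κ) (hg : Measurable g) (E : Set Ω) :
    μ E = ∑' y, μ (E ∩ {ω | g ω = y}) := by
  have h := tsum_measure_preimage_singleton (μ := μ.restrict E) (s := (Set.univ : Set κ))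
    Set.countable_univ (f := g) (fun y _ => hg (measurableSet_singleton y))
  rw [tsum_univ (fun y => (μ.restrict E) (g ⁻¹' {y}))] at h
  simp only [Set.preimage_univ, Measure.restrict_apply_univ] at h
  rw [← h]
  apply tsum_congr; intro y
  rw [Measure.restrict_apply (hg (measurableSet_singleton y)), Set.inter_comm]
  rfl

lemma detBy_meas (ξ : ℕ → Ω → ℤ) (hξ : ∀ n, Measurable (ξ n)) (n : ℕ) (E : Set Ω)
    (hE : DetBy ξ n E) : MeasurableSet E := by
  set path : Ω → (Fin (n + 1) → ℤ) := fun ω i => ξ i ω with hpath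
  have hm : Measurable path := measurable_pi_lambda _ (fun i => hξ i)
  have : E = path ⁻¹' (path '' E) := by
    apply Set.Subset.antisymm (Set.subset_preimage_image _ _)
    rintro ω ⟨ω', h', he⟩
    refine hE ω' ω (fun i hi => ?_) h'
    exact congrFun he ⟨i, by omega⟩
  rw [this]
  exact hm (Set.to_countable _).measurableSet

lemma step_nonneg (p : UnitAddCircle → ℝ) (hp : ∀ z, 0 ≤ p z ∧ p z ≤ 1) (α : ℝ) (x : UnitAddCircle)
    (i j : ℤ) : 0 ≤ stepProb p α x i j := by
  unfold stepProb
  split_ifs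
  · exact (hp _).1
  · exact sub_nonneg.2 (hp _).2
  · exact le_rfl

lemma markov (p : UnitAddCircle → ℝ) (hp : ∀ z, 0 ≤ p z ∧ p z ≤ 1) (α : ℝ) (x : UnitAddCircle)
    (ℙ : Measure Ω) (ξ : ℕ → Ω → ℤ) (hW : IsQPWalk p α x 0 ℙ ξ) (n : ℕ) (E : Set Ω)
    (hE : DetBy ξ n E) (i j : ℤ) :
    ℙ (E ∩ {ω | ξ n ω = i} ∩ {ω | ξ (n + 1) ω = j}) =
      ℙ (E ∩ {ω | ξ n ω = i}) * ENNReal.ofReal (stepProb p α x i j) := by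
  obtain ⟨hprob, hm, hfdd⟩ := hW
  set path : Ω → (Fin (n + 1) → ℤ) := fun ω i => ξ i ω with hpath
  have hpm : Measurable path := measurable_pi_lambda _ (fun i => hm i)
  rw [meas_part ℙ path hpm, meas_part ℙ path hpm (E ∩ {ω | ξ n ω = i}), ← ENNReal.tsum_mul_right]
  apply tsum_congr
  intro k
  by_cases hne : ∃ ω, ω ∈ E ∧ ξ n ω = i ∧ path ω = k
  · obtain ⟨ω₀, hω₀, hi, hk⟩ := hne
    set K : ℕ → ℤ := fun l => if l ≤ n then ξ l ω₀ else j with hK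
    have hpk : ∀ ω, path ω = k ↔ ∀ l ≤ n, ξ l ω = K l := by
      intro ω
      rw [← hk]
      constructor
      · intro h l hl
        simp only [hK, hl, if_true]
        exact congrFun h ⟨l, by omega⟩
      · intro h
        funext l
        have hl : (l : ℕ) ≤ n := by omega
        have := h l hl
        simp only [hK, hl, if_true] at this
        exact this
    have e1 : E ∩ {ω | ξ n ω = i} ∩ {ω | path ω = k} = {ω | ∀ l ≤ n, ξ l ω = K l} := by
      ext ω
      simp only [Set.mem_inter_iff, Set.mem_ofPred_eq, hpk]
      constructor
      · exact fun h => h.2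
      · intro h
        refine ⟨⟨?_, ?_⟩, h⟩
        · refine hE ω₀ ω (fun l hl => ?_) hω₀
          rw [h l hl]; simp [hK, hl]
        · rw [h n le_rfl]; simp [hK, hi]
    have e2 : E ∩ {ω | ξ n ω = i} ∩ {ω | ξ (n + 1) ω = j} ∩ {ω | path ω = k} =
        {ω | ∀ l ≤ n + 1, ξ l ω = K l} := by
      have : E ∩ {ω | ξ n ω = i} ∩ {ω | ξ (n + 1) ω = j} ∩ {ω | path ω = k} =
        (E ∩ {ω | ξ n ω = i} ∩ {ω | path ω = k}) ∩ {ω | ξ (n + 1) ω = j} := by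
        ext ω; simp only [Set.mem_inter_iff]; tauto
      rw [this, e1]
      ext ω
      simp only [Set.mem_inter_iff, Set.mem_ofPred_eq]
      constructor
      · rintro ⟨h1, h2⟩ l hl
        by_cases hl' : l ≤ n
        · exact h1 l hl'
        · obtain rfl : l = n + 1 := by omega
          rw [h2]; simp [hK]
      · intro h
        refine ⟨fun l hl => h l (by omega), ?_⟩
        rw [h (n + 1) le_rfl]; simp [hK]
    rw [e1, e2, hfdd, hfdd, Finset.prod_range_succ, ← mul_assoc,
      ENNReal.ofReal_mul' (step_nonneg p hp α x _ _)]
    congr 3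
    · simp [hK, hi]
    · simp [hK]
  · have e1 : E ∩ {ω | ξ n ω = i} ∩ {ω | path ω = k} = ∅ := by
      ext ω
      simp only [Set.mem_inter_iff, Set.mem_ofPred_eq, Set.mem_empty_iff_false, iff_false]
      exact fun h => hne ⟨ω, h.1.1, h.1.2, h.2⟩
    have e2 : E ∩ {ω | ξ n ω = i} ∩ {ω | ξ (n + 1) ω = j} ∩ {ω | path ω = k} = ∅ := by
      ext ω
      simp only [Set.mem_inter_iff, Set.mem_ofPred_eq, Set.mem_empty_iff_false, iff_false]
      exact fun h => hne ⟨ω, h.1.1.1, h.1.1.2, h.2⟩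
    rw [e1, e2]; simp

lemma start_prob (p : UnitAddCircle → ℝ) (α : ℝ) (x : UnitAddCircle)
    (ℙ : Measure Ω) (ξ : ℕ → Ω → ℤ) (hW : IsQPWalk p α x 0 ℙ ξ) (j : ℤ) :
    ℙ {ω | ξ 0 ω = j} = if j = 0 then 1 else 0 := by
  have := hW.2.2 0 (fun _ => j)
  simp only [Nat.le_zero, forall_eq, Finset.range_zero, Finset.prod_empty, mul_one] at this
  rw [this]
  split_ifs <;> simp

/-- survival event -/
def survD (ξ : ℕ → Ω → ℤ) (m : ℕ) : Set Ω := {ω | ∀ i, 1 ≤ i → i ≤ m → ξ i ω ≠ 0}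

lemma survD_det (ξ : ℕ → Ω → ℤ) (m : ℕ) : DetBy ξ m (survD ξ m) := by
  intro ω ω' h hω i h1 hi
  rw [← h i hi]; exact hω i h1 hi

lemma survU_step (p : UnitAddCircle → ℝ) (hp : ∀ z, 0 ≤ p z ∧ p z ≤ 1) (α : ℝ) (x : UnitAddCircle)
    (n : ℕ) (i : ℤ) : ENNReal.ofReal (survU p α x (n + 1) i) =
    ∑' j, ENNReal.ofReal (stepProb p α x i j) *
      (if j = 0 then 0 else ENNReal.ofReal (survU p α x n j)) := by
  have hne : i + 1 ≠ i - 1 := by omega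
  rw [tsum_eq_sum (s := {i + 1, i - 1})]
  · rw [Finset.sum_pair hne]
    have c : ∀ j : ℤ, (if j = 0 then 0 else ENNReal.ofReal (survU p α x n j)) =
        ENNReal.ofReal (if j = 0 then 0 else survU p α x n j) := by
      intro j; split_ifs <;> simp
    rw [c, c, ← ENNReal.ofReal_mul (step_nonneg p hp α x _ _), ← ENNReal.ofReal_mul (step_nonneg p hp α x _ _),
      ← ENNReal.ofReal_add]
    · congr 1
      simp only [survU, stepProb, if_true, if_neg hne.symm]
    · apply mul_nonneg (step_nonneg p hp α x _ _)
      split_ifs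
      · exact le_rfl
      · exact (survU_mem p hp α x n _).1
    · apply mul_nonneg (step_nonneg p hp α x _ _)
      split_ifs
      · exact le_rfl
      · exact (survU_mem p hp α x n _).1
  · intro j hj
    simp only [Finset.mem_insert, Finset.mem_singleton, not_or] at hj
    simp [stepProb, hj.1, hj.2]

lemma surv_shift (p : UnitAddCircle → ℝ) (hp : ∀ z, 0 ≤ p z ∧ p z ≤ 1) (α : ℝ) (x : UnitAddCircle)
    (ℙ : Measure Ω) (ξ : ℕ → Ω → ℤ) (hW : IsQPWalk p α x 0 ℙ ξ) (m n : ℕ) :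
    ∑' j, ℙ (survD ξ m ∩ {ω | ξ m ω = j}) * ENNReal.ofReal (survU p α x (n + 1) j) =
    ∑' j, ℙ (survD ξ (m + 1) ∩ {ω | ξ (m + 1) ω = j}) * ENNReal.ofReal (survU p α x n j) := by
  have e : ∀ i, ℙ (survD ξ m ∩ {ω | ξ m ω = i}) * ENNReal.ofReal (survU p α x (n + 1) i) =
      ∑' j, ℙ (survD ξ m ∩ {ω | ξ (m+1) ω = j} ∩ {ω | ξ m ω = i}) *
        (if j = 0 then 0 else ENNReal.ofReal (survU p α x n j)) := by
    intro i
    rw [survU_step p hp, ← ENNReal.tsum_mul_left]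
    apply tsum_congr; intro j
    rw [← mul_assoc, ← markov p hp α x ℙ ξ hW m _ (survD_det ξ m), Set.inter_right_comm]
  rw [tsum_congr e, ENNReal.tsum_comm]
  apply tsum_congr; intro j
  rw [ENNReal.tsum_mul_right, ← meas_part ℙ (ξ m) (hW.2.1 m)]
  by_cases hj : j = 0
  · have : survD ξ (m + 1) ∩ {ω | ξ (m + 1) ω = j} = ∅ := by
      ext ω
      simp only [Set.mem_inter_iff, Set.mem_ofPred_eq, Set.mem_empty_iff_false, iff_false]
      rintro ⟨h1, h2⟩
      exact h1 (m + 1) (by omega) le_rfl (h2.trans hj)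
    rw [this]; simp [hj]
  · have : survD ξ (m + 1) ∩ {ω | ξ (m + 1) ω = j} = survD ξ m ∩ {ω | ξ (m + 1) ω = j} := by
      ext ω
      simp only [Set.mem_inter_iff, Set.mem_ofPred_eq, survD]
      constructor
      · rintro ⟨h1, h2⟩
        exact ⟨fun i a b => h1 i a (by omega), h2⟩
      · rintro ⟨h1, h2⟩
        refine ⟨fun i a b => ?_, h2⟩
        by_cases hi : i ≤ m
        · exact h1 i a hi
        · obtain rfl : i = m + 1 := by omega
          rw [h2]; exact hj
    rw [this]; simp [hj]

lemma surv_eq (p : UnitAddCircle → ℝ) (hp : ∀ z, 0 ≤ p z ∧ p z ≤ 1) (α : ℝ) (x : UnitAddCircle)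
    (ℙ : Measure Ω) (ξ : ℕ → Ω → ℤ) (hW : IsQPWalk p α x 0 ℙ ξ) (n : ℕ) :
    ℙ (survD ξ n) = ENNReal.ofReal (survU p α x n 0) := by
  have key : ∀ m n, ∑' j, ℙ (survD ξ m ∩ {ω | ξ m ω = j}) * ENNReal.ofReal (survU p α x n j) =
      ENNReal.ofReal (survU p α x (m + n) 0) := by
    intro m
    induction m with
    | zero =>
      intro n
      have : survD ξ 0 = Set.univ := by
        ext ω; simp only [survD, Set.mem_ofPred_eq, Set.mem_univ, iff_true]; intro i a b; omega
      simp only [this, Set.univ_inter, start_prob p α x ℙ ξ hW]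
      rw [tsum_eq_single 0]
      · simp
      · intro j hj; simp [hj]
    | succ m ih =>
      intro n
      rw [← surv_shift p hp α x ℙ ξ hW, ih]
      congr 2; ring
  have := key n 0
  simp only [survU, ENNReal.ofReal_one, mul_one, add_zero] at this
  rw [← this, ← meas_part ℙ (ξ n) (hW.2.1 n)]

lemma parity (p : UnitAddCircle → ℝ) (hp : ∀ z, 0 ≤ p z ∧ p z ≤ 1) (α : ℝ) (x : UnitAddCircle)
    (ℙ : Measure Ω) (ξ : ℕ → Ω → ℤ) (hW : IsQPWalk p α x 0 ℙ ξ) :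
    ∀ᵐ ω ∂ℙ, ∀ n : ℕ, (ξ n ω - n) % 2 = 0 := by
  have h0 : ∀ᵐ ω ∂ℙ, ∀ j : ℤ, j ≠ 0 → ξ 0 ω ≠ j := by
    rw [ae_all_iff]; intro j
    by_cases hj : j = 0
    · simp [hj]
    · have := start_prob p α x ℙ ξ hW j
      rw [if_neg hj] at this
      rw [ae_iff]; simpa [hj] using this
  have hs : ∀ᵐ ω ∂ℙ, ∀ (n : ℕ) (i j : ℤ), j ≠ i + 1 → j ≠ i - 1 → ¬ (ξ n ω = i ∧ ξ (n + 1) ω = j) := by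
    simp only [ae_all_iff]
    intro n i j h1 h2
    have := markov p hp α x ℙ ξ hW n Set.univ (fun _ _ _ _ => trivial) i j
    rw [ae_iff]
    simp only [not_not]
    simp only [stepProb, h1, h2, if_false, ENNReal.ofReal_zero, mul_zero, Set.univ_inter] at this
    exact this
  filter_upwards [h0, hs] with ω h0 hs n
  induction n with
  | zero =>
    have : ξ 0 ω = 0 := by
      by_contra h; exact h0 _ h rfl
    simp [this]
  | succ n ih =>
    have : ξ (n + 1) ω = ξ n ω + 1 ∨ ξ (n + 1) ω = ξ n ω - 1 := by
      by_contra h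
      push Not at h
      exact hs n _ _ h.1 h.2 ⟨rfl, rfl⟩
    push_cast
    omega

lemma straight (p : UnitAddCircle → ℝ) (hp : ∀ z, 0 ≤ p z ∧ p z ≤ 1) (α : ℝ) (x : UnitAddCircle)
    (c : ℝ) (hcp : ∀ z, c ≤ p z ∧ c ≤ 1 - p z) (hc : 0 ≤ c)
    (ℙ : Measure Ω) (ξ : ℕ → Ω → ℤ) (hW : IsQPWalk p α x 0 ℙ ξ) (n : ℕ) (E : Set Ω)
    (hE : DetBy ξ n E) (a s : ℤ) (hs : s = 1 ∨ s = -1) (m : ℕ) :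
    DetBy ξ (n + m) (E ∩ {ω | ∀ i ≤ m, ξ (n + i) ω = a - s * i}) ∧
    ℙ (E ∩ {ω | ξ n ω = a}) * ENNReal.ofReal (c ^ m) ≤
      ℙ (E ∩ {ω | ∀ i ≤ m, ξ (n + i) ω = a - s * i}) := by
  refine ⟨?_, ?_⟩
  · rintro ω ω' h ⟨h1, h2⟩
    refine ⟨hE ω ω' (fun i hi => h i (by omega)) h1, fun i hi => ?_⟩
    rw [← h (n + i) (by omega)]; exact h2 i hi
  induction m with
  | zero => simp
  | succ m ih =>
    set G := E ∩ {ω | ∀ i ≤ m, ξ (n + i) ω = a - s * i} with hG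
    have hdet : DetBy ξ (n + m) G := by
      rintro ω ω' h ⟨h1, h2⟩
      refine ⟨hE ω ω' (fun i hi => h i (by omega)) h1, fun i hi => ?_⟩
      rw [← h (n + i) (by omega)]; exact h2 i hi
    have hmk := markov p hp α x ℙ ξ hW (n + m) G hdet (a - s * m) (a - s * (m + 1))
    have e1 : G ∩ {ω | ξ (n + m) ω = a - s * m} = G := by
      apply Set.inter_eq_left.2
      rintro ω ⟨_, h2⟩
      exact h2 m le_rfl
    have e2 : E ∩ {ω | ∀ i ≤ m + 1, ξ (n + i) ω = a - s * i} =
        G ∩ {ω | ξ (n + m + 1) ω = a - s * (m + 1)} := by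
      ext ω
      simp only [hG, Set.mem_inter_iff, Set.mem_ofPred_eq]
      constructor
      · rintro ⟨h1, h2⟩
        refine ⟨⟨h1, fun i hi => h2 i (by omega)⟩, ?_⟩
        have := h2 (m + 1) le_rfl
        push_cast at this
        exact this
      · rintro ⟨⟨h1, h2⟩, h3⟩
        refine ⟨h1, fun i hi => ?_⟩
        by_cases h : i ≤ m
        · exact h2 i h
        · obtain rfl : i = m + 1 := by omega
          push_cast; exact h3
    rw [e1] at hmk
    rw [e2, hmk, pow_succ, ENNReal.ofReal_mul (by positivity), ← mul_assoc]
    apply mul_le_mul' ih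
    apply ENNReal.ofReal_le_ofReal
    unfold stepProb
    rcases hs with rfl | rfl
    · rw [if_neg (by omega), if_pos (by ring)]; exact (hcp _).2
    · rw [if_pos (by ring)]; exact (hcp _).1

lemma main_bound (p : UnitAddCircle → ℝ) (hp : ∀ z, 0 ≤ p z ∧ p z ≤ 1) (α : ℝ) (x : UnitAddCircle)
    (c : ℝ) (hcp : ∀ z, c ≤ p z ∧ c ≤ 1 - p z) (hc : 0 ≤ c)
    (ℙ : Measure Ω) (ξ : ℕ → Ω → ℤ) (hW : IsQPWalk p α x 0 ℙ ξ) (n₀ : ℕ) (a : ℤ) :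
    (∑' j : ℕ, ℙ {ω | (∀ i, 1 ≤ i → i < n₀ + 1 + j → ξ (2 * i) ω ≠ 0) ∧
              ξ (2 * (n₀ + 1 + j)) ω = a}) * ENNReal.ofReal (c ^ a.natAbs) ≤
      ENNReal.ofReal (survU p α x (2 * n₀) 0) := by
  obtain ⟨s, hs, hsa⟩ : ∃ s : ℤ, (s = 1 ∨ s = -1) ∧ a = s * a.natAbs := by
    rcases le_total 0 a with h | h
    · exact ⟨1, Or.inl rfl, by omega⟩
    · exact ⟨-1, Or.inr rfl, by omega⟩
  set m := a.natAbs with hm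
  set B : ℕ → Set Ω := fun j => survD ξ (2 * (n₀ + 1 + j) - 1) ∩
    {ω | ∀ i ≤ m, ξ (2 * (n₀ + 1 + j) + i) ω = a - s * i} with hB
  have hdet : ∀ j, DetBy ξ (2 * (n₀ + 1 + j)) (survD ξ (2 * (n₀ + 1 + j) - 1)) := by
    intro j ω ω' h
    exact survD_det ξ _ ω ω' (fun i hi => h i (by omega))
  have hst := fun j => straight p hp α x c hcp hc ℙ ξ hW _ _ (hdet j) a s hs m
  have hBsurv : ∀ j, ∀ ω ∈ B j, ∀ i, 1 ≤ i → i < 2 * (n₀ + 1 + j) + m → ξ i ω ≠ 0 := by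
    rintro j ω ⟨h1, h2⟩ i hi1 hi2
    by_cases h : i < 2 * (n₀ + 1 + j)
    · exact h1 i hi1 (by omega)
    · obtain ⟨l, rfl⟩ := Nat.exists_eq_add_of_le (not_lt.1 h)
      rw [h2 l (by omega)]
      rcases hs with rfl | rfl <;> omega
  have hBend : ∀ j, ∀ ω ∈ B j, ξ (2 * (n₀ + 1 + j) + m) ω = 0 := by
    rintro j ω ⟨h1, h2⟩
    rw [h2 m le_rfl]; linarith
  have hdisj : Pairwise (Function.onFun Disjoint B) := by
    have : ∀ j k, j < k → Disjoint (B j) (B k) := by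
      intro j k hjk
      rw [Set.disjoint_left]
      intro ω h1 h2
      exact hBsurv k ω h2 _ (by omega) (by omega) (hBend j ω h1)
    intro j k hjk
    rcases lt_or_gt_of_ne hjk with h | h
    · exact this j k h
    · exact (this k j h).symm
  have hae := parity p hp α x ℙ ξ hW
  have hA : ∀ j, ℙ {ω | (∀ i, 1 ≤ i → i < n₀ + 1 + j → ξ (2 * i) ω ≠ 0) ∧
              ξ (2 * (n₀ + 1 + j)) ω = a} ≤
      ℙ (survD ξ (2 * (n₀ + 1 + j) - 1) ∩ {ω | ξ (2 * (n₀ + 1 + j)) ω = a}) := by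
    intro j
    apply measure_mono_ae
    filter_upwards [hae] with ω hω
    rintro ⟨h1, h2⟩
    refine ⟨fun i hi1 hi2 => ?_, h2⟩
    rcases Nat.even_or_odd' i with ⟨k, rfl | rfl⟩
    · exact h1 k (by omega) (by omega)
    · have := hω (2 * k + 1)
      push_cast at this
      omega
  rw [← ENNReal.tsum_mul_right]
  calc _ ≤ ∑' j, ℙ (B j) := by
        apply ENNReal.tsum_le_tsum; intro j
        exact (mul_le_mul' (hA j) le_rfl).trans (hst j).2
    _ ≤ ℙ (⋃ j, B j) := tsum_meas_le_meas_iUnion_of_disjoint ℙ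
        (fun j => detBy_meas ξ hW.2.1 _ _ (hst j).1) hdisj
    _ ≤ ℙ (survD ξ (2 * n₀)) := by
        apply measure_mono
        apply Set.iUnion_subset
        rintro j ω ⟨h1, _⟩ i hi1 hi2
        exact h1 i hi1 (by omega)
    _ = _ := surv_eq p hp α x ℙ ξ hW _

end walk

/-- Lemma A.2: let `ζ_n = ξ_{2n}`. For every `ε > 0` and `q ≥ 2`
there is `n₀` such that `Σ_{k=n₀+1}^∞ ℙ_x(ζ_1 ≠ 0, …, ζ_{k-1} ≠ 0, ζ_k = a) < ε` for
every `x ∈ 𝕋` and every `a` with `|a| ≤ q`. -/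
theorem statement18 (α : ℝ) (hα : Irrational α) (𝔣 : UnitAddCircle → ℝ)
    (h𝔣 : ZeroMeanBV 𝔣) (ε : ℝ) (hε : 0 < ε) (q : ℕ) (hq : 2 ≤ q) :
    ∃ n₀ : ℕ, ∀ (x : UnitAddCircle) (Ω : Type) [MeasurableSpace Ω] (ℙ : Measure Ω)
      (ξ : ℕ → Ω → ℤ), IsQPWalk (pOf 𝔣) α x 0 ℙ ξ →
      ∀ a : ℤ, |a| ≤ (q : ℤ) →
        (∑' j : ℕ,
          (ℙ {ω | (∀ i, 1 ≤ i → i < n₀ + 1 + j → ξ (2 * i) ω ≠ 0) ∧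
              ξ (2 * (n₀ + 1 + j)) ω = a}).toReal) < ε := by

  have hp : ∀ z, 0 ≤ pOf 𝔣 z ∧ pOf 𝔣 z ≤ 1 := fun z => ⟨(pOf_mem 𝔣 z).1.le, (pOf_mem 𝔣 z).2.le⟩
  obtain ⟨c, hc0, hc1, hcp⟩ : ∃ c : ℝ, 0 < c ∧ c ≤ 1 ∧ ∀ z, c ≤ pOf 𝔣 z ∧ c ≤ 1 - pOf 𝔣 z := by
    have hcont := pOf_cont 𝔣 h𝔣.1
    obtain ⟨z₀, -, hz⟩ := isCompact_univ.exists_isMinOn Set.univ_nonempty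
      (hcont.min (continuous_const.sub hcont) : Continuous (fun z => min (pOf 𝔣 z) (1 - pOf 𝔣 z))).continuousOn
    have hle : ∀ z, min (pOf 𝔣 z₀) (1 - pOf 𝔣 z₀) ≤ min (pOf 𝔣 z) (1 - pOf 𝔣 z) := fun z => hz (Set.mem_univ z)
    refine ⟨min (pOf 𝔣 z₀) (1 - pOf 𝔣 z₀), ?_, ?_, ?_⟩
    · exact lt_min (pOf_mem 𝔣 z₀).1 (sub_pos.2 (pOf_mem 𝔣 z₀).2)
    · exact (min_le_left _ _).trans (hp z₀).2
    · exact fun z => ⟨(hle z).trans (min_le_left _ _), (hle z).trans (min_le_right _ _)⟩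
  obtain ⟨N, hN⟩ := survU_unif α hα 𝔣 h𝔣 (ε * c ^ q) (by positivity)
  refine ⟨N, ?_⟩
  intro x Ω _ ℙ ξ hW a ha
  have hfin := hW.1
  have hb := main_bound (pOf 𝔣) hp α x c hcp hc0.le ℙ ξ hW N a
  rw [← ENNReal.tsum_toReal_eq (fun j => measure_ne_top ℙ _)]
  set S := ∑' j : ℕ, ℙ {ω | (∀ i, 1 ≤ i → i < N + 1 + j → ξ (2 * i) ω ≠ 0) ∧
              ξ (2 * (N + 1 + j)) ω = a} with hS
  have h1 := ENNReal.toReal_mono ENNReal.ofReal_ne_top hb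
  rw [ENNReal.toReal_mul, ENNReal.toReal_ofReal (by positivity),
    ENNReal.toReal_ofReal (survU_mem _ hp α x _ 0).1] at h1
  have h2 := hN (2 * N) (by omega) x
  have h3 : c ^ q ≤ c ^ a.natAbs := pow_le_pow_of_le_one hc0.le hc1 (by
    have := abs_le.1 ha; omega)
  have h4 : S.toReal * c ^ a.natAbs < ε * c ^ a.natAbs :=
    h1.trans_lt (h2.trans_le (mul_le_mul_of_nonneg_left h3 hε.le))
  exact lt_of_mul_lt_mul_right h4 (by positivity)
end
end
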